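/- arXiv:2201.09446 — 3 statements merged into one kernel-verified Lean document; each statement's English description precedes it below -/
import Mathlib

section
/- There exists a positive constant C₁, independent of k, such that for every k ∈ ℤ₊: ‖v_k'‖_{L^∞(ℝ)} ≤ C₁ E_k^{7/2 - 1/(4n+4)} and ‖w_k'‖_{L^∞(ℝ)} ≤ C₁ Ẽ_k^{7/2 - 1/(4n+4)}, where E_k = 4k(n+1)+2n+1 and Ẽ_k = 4k(n+1)+2n+3. -/
open MeasureTheory

/-- Generalized binomial coefficient `binom(a, j) = a (a-1) ⋯ (a-j+1) / j!`. -/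
noncomputable def genBinom (a : ℝ) (j : ℕ) : ℝ :=
  (∏ i ∈ Finset.range j, (a - i)) / (Nat.factorial j : ℝ)

/-- Generalized Laguerre polynomial
`L_k^{(a)}(s) = Σ_{i=0}^{k} (-1)^i binom(k+a, k-i) s^i / i!`. -/
noncomputable def laguerre (a : ℝ) (k : ℕ) (s : ℝ) : ℝ :=
  ∑ i ∈ Finset.range (k + 1),
    (-1 : ℝ) ^ i * genBinom ((k : ℝ) + a) (k - i) * s ^ i / (Nat.factorial i : ℝ)

/-- The (unnormalized) even-parity eigenfunction
`v_k(t) = e^{-t^{2n+2}/(2n+2)} L_k^{(-1/(2n+2))}(t^{2n+2}/(n+1))`. -/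
noncomputable def vk (n k : ℕ) (t : ℝ) : ℝ :=
  Real.exp (-(t ^ (2 * n + 2)) / (2 * (n : ℝ) + 2)) *
    laguerre (-(1 / (2 * (n : ℝ) + 2))) k (t ^ (2 * n + 2) / ((n : ℝ) + 1))

/-- The (unnormalized) odd-parity eigenfunction
`w_k(t) = e^{-t^{2n+2}/(2n+2)} t L_k^{(1/(2n+2))}(t^{2n+2}/(n+1))`. -/
noncomputable def wk (n k : ℕ) (t : ℝ) : ℝ :=
  Real.exp (-(t ^ (2 * n + 2)) / (2 * (n : ℝ) + 2)) * t *
    laguerre (1 / (2 * (n : ℝ) + 2)) k (t ^ (2 * n + 2) / ((n : ℝ) + 1))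

/-- `v_k` normalized so that `∫_ℝ t^{2n} v_k(t)² dt = 1`. -/
noncomputable def nvk (n k : ℕ) (t : ℝ) : ℝ :=
  vk n k t / Real.sqrt (∫ s : ℝ, s ^ (2 * n) * (vk n k s) ^ 2)

/-- `w_k` normalized so that `∫_ℝ t^{2n} w_k(t)² dt = 1`. -/
noncomputable def nwk (n k : ℕ) (t : ℝ) : ℝ :=
  wk n k t / Real.sqrt (∫ s : ℝ, s ^ (2 * n) * (wk n k s) ^ 2)


/-- The exponential factor. -/
noncomputable def ex (n : ℕ) (t : ℝ) : ℝ :=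
  Real.exp (-(t ^ (2 * n + 2)) / (2 * (n : ℝ) + 2))

lemma ex_hasDeriv (n : ℕ) (t : ℝ) : HasDerivAt (ex n) (-(t ^ (2 * n + 1)) * ex n t) t := by
  have h : HasDerivAt (fun t : ℝ => -(t ^ (2 * n + 2)) / (2 * (n : ℝ) + 2))
      (-(t ^ (2 * n + 1))) t := by
    have h1 := ((hasDerivAt_pow (2 * n + 2) t).neg).div_const (2 * (n : ℝ) + 2)
    refine h1.congr_deriv ?_
    have : (2 * (n : ℝ) + 2) ≠ 0 := by positivity
    push_cast
    field_simp
  have h2 := h.exp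
  refine h2.congr_deriv ?_
  unfold ex
  ring

lemma integ_pow (n j : ℕ) : Integrable (fun t : ℝ => t ^ j * ex n t ^ 2) := by
  have hb : (0 : ℝ) < 1 / ((n : ℝ) + 1) := by positivity
  have h := (integrable_rpow_mul_exp_neg_mul_sq hb (s := (j : ℝ))
    (by have : (0 : ℝ) ≤ j := by positivity
        linarith)).const_mul (Real.exp (1 / ((n : ℝ) + 1)))
  refine h.mono ?_ ?_
  · apply Continuous.aestronglyMeasurable
    unfold ex
    fun_prop
  · refine Filter.Eventually.of_forall fun t => ?_
    simp only [Real.rpow_natCast, norm_mul, norm_pow, Real.norm_eq_abs, Real.abs_exp]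
    rw [mul_left_comm]
    refine mul_le_mul_of_nonneg_left ?_ (by positivity)
    unfold ex
    rw [Real.abs_exp, ← Real.exp_nat_mul, ← Real.exp_add]
    apply Real.exp_le_exp.mpr
    have h1 : t ^ 2 - 1 ≤ t ^ (2 * n + 2) := by
      have : t ^ (2 * n + 2) = (t ^ 2) ^ (n + 1) := by rw [← pow_mul]; ring_nf
      rw [this]
      rcases le_total 1 (t ^ 2) with h | h
      · have := le_self_pow₀ h (Nat.succ_ne_zero n)
        simp only [Nat.succ_eq_add_one] at this
        linarith
      · have : 0 ≤ (t ^ 2) ^ (n + 1) := by positivity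
        linarith
    have e1 : ((2 : ℕ) : ℝ) * (-(t ^ (2 * n + 2)) / (2 * (n : ℝ) + 2))
        = 1 / ((n : ℝ) + 1) * (-(t ^ (2 * n + 2))) := by
      push_cast; field_simp
    rw [e1]
    nlinarith

lemma integ_poly (n : ℕ) (q : Polynomial ℝ) :
    Integrable (fun t : ℝ => q.eval t * ex n t ^ 2) := by
  induction q using Polynomial.induction_on' with
  | add p q hp hq =>
    simp only [Polynomial.eval_add, add_mul]
    exact hp.add hq
  | monomial j a =>
    simp only [Polynomial.eval_monomial, mul_assoc]
    exact (integ_pow n j).const_mul a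

open Polynomial in
lemma pe_hasDeriv (n : ℕ) (p : ℝ[X]) (t : ℝ) :
    HasDerivAt (fun t => p.eval t * ex n t)
      ((derivative p - X ^ (2 * n + 1) * p).eval t * ex n t) t := by
  have h := (p.hasDerivAt t).mul (ex_hasDeriv n t)
  refine h.congr_deriv ?_
  simp; ring

open Polynomial in
lemma peq_hasDeriv (n : ℕ) (p : ℝ[X]) (t : ℝ) :
    HasDerivAt (fun t => p.eval t * ex n t ^ 2)
      ((derivative p - 2 * X ^ (2 * n + 1) * p).eval t * ex n t ^ 2) t := by
  have h := (p.hasDerivAt t).mul ((ex_hasDeriv n t).pow 2)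
  refine h.congr_deriv ?_
  simp; ring

open Polynomial in
/-- Integral functional. -/
noncomputable def II (n : ℕ) (q : ℝ[X]) : ℝ := ∫ t : ℝ, q.eval t * ex n t ^ 2

open Polynomial in
lemma II_add (n : ℕ) (p q : ℝ[X]) : II n (p + q) = II n p + II n q := by
  unfold II
  rw [← integral_add (integ_poly n p) (integ_poly n q)]
  simp [add_mul]

open Polynomial in
lemma II_smul (n : ℕ) (a : ℝ) (q : ℝ[X]) : II n (C a * q) = a * II n q := by
  unfold II
  rw [← integral_const_mul]
  simp [mul_assoc]

open Polynomial in
lemma II_mono (n : ℕ) (p q : ℝ[X]) (h : ∀ t, p.eval t ≤ q.eval t) : II n p ≤ II n q := by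
  unfold II
  refine integral_mono (integ_poly n p) (integ_poly n q) fun t => ?_
  exact mul_le_mul_of_nonneg_right (h t) (by positivity)

open Polynomial in
lemma II_nonneg (n : ℕ) (q : ℝ[X]) (h : ∀ t, 0 ≤ q.eval t) : 0 ≤ II n q := by
  unfold II
  exact integral_nonneg fun t => mul_nonneg (h t) (by positivity)

open Polynomial in
lemma II_deriv (n : ℕ) (q : ℝ[X]) : II n (derivative q - 2 * X ^ (2 * n + 1) * q) = 0 :=
  integral_eq_zero_of_hasDerivAt_of_integrable (peq_hasDeriv n q) (integ_poly n _)
    (integ_poly n q)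

open Polynomial in
lemma sup_bound (n : ℕ) (q r : ℝ[X])
    (h : ∀ t, (derivative q - 2 * X ^ (2 * n + 1) * q).eval t ≤ r.eval t)
    (hr : ∀ t, 0 ≤ r.eval t) (t : ℝ) : q.eval t * ex n t ^ 2 ≤ II n r := by
  have h0 := tendsto_zero_of_hasDerivAt_of_integrableOn_Iic (a := t)
    (fun x _ => peq_hasDeriv n q x) (integ_poly n _).integrableOn (integ_poly n q).integrableOn
  have h1 := integral_Iic_of_hasDerivAt_of_tendsto' (a := t)
    (fun x _ => peq_hasDeriv n q x) (integ_poly n _).integrableOn h0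
  rw [sub_zero] at h1
  rw [← h1]
  calc _ ≤ ∫ x in Set.Iic t, r.eval x * ex n x ^ 2 := by
        refine setIntegral_mono (integ_poly n _).integrableOn (integ_poly n _).integrableOn ?_
        intro x
        exact mul_le_mul_of_nonneg_right (h x) (by positivity)
    _ ≤ _ := by
        refine setIntegral_le_integral (integ_poly n r) ?_
        exact Filter.Eventually.of_forall fun x => mul_nonneg (hr x) (by positivity)

open Polynomial in
/-- Virial inequality. -/
lemma virial (n : ℕ) (E : ℝ) (p w : ℝ[X])
    (hp : derivative (derivative p) - 2 * X ^ (2 * n + 1) * derivative p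
      + C (E - (2 * n + 1)) * X ^ (2 * n) * p = 0) :
    II n (w * (derivative p - X ^ (2 * n + 1) * p) ^ 2) + II n (w * X ^ (4 * n + 2) * p ^ 2)
      = E * II n (w * X ^ (2 * n) * p ^ 2)
        + (1 / 2) * II n (derivative (derivative w) * p ^ 2) := by
  have h := II_deriv n (w * p * (derivative p - X ^ (2 * n + 1) * p)
    - C (1 / 2) * derivative w * p ^ 2)
  have hE : C E = C (E - (2 * n + 1)) + (2 * (n : ℝ[X]) + 1) := by
    simp only [map_sub, map_add, map_mul, map_ofNat, map_natCast, map_one]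
    ring
  have h2 : (2 : ℝ[X]) * C (1 / 2) = 1 := by
    rw [← C_ofNat, ← C_mul]; norm_num
  have e : derivative (w * p * (derivative p - X ^ (2 * n + 1) * p)
      - C (1 / 2) * derivative w * p ^ 2) - 2 * X ^ (2 * n + 1) *
      (w * p * (derivative p - X ^ (2 * n + 1) * p) - C (1 / 2) * derivative w * p ^ 2)
      = w * (derivative p - X ^ (2 * n + 1) * p) ^ 2 + w * X ^ (4 * n + 2) * p ^ 2
       + C (-E) * (w * X ^ (2 * n) * p ^ 2)
       + C (-(1 / 2)) * (derivative (derivative w) * p ^ 2) := by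
    simp only [derivative_sub, derivative_mul, derivative_C, derivative_X, derivative_pow,
      C_neg, hE]
    push_cast
    simp only [map_add, map_mul, map_ofNat, map_natCast, map_one, Nat.add_sub_cancel]
    have hp2 := congrArg (fun z => w * p * z) hp
    simp only [mul_zero] at hp2
    linear_combination hp2 - (derivative w * p * derivative p
      - derivative w * p ^ 2 * X ^ (2 * n + 1)) * h2
  rw [e, II_add, II_add, II_add, II_smul, II_smul] at h
  linarith

lemma even_pow_le (a b c d : ℕ) (hab : a ≤ b) (hbc : b ≤ c) (x : ℝ) :
    x ^ (2 * b) ≤ x ^ (2 * a) + x ^ (2 * c) + 0 * d := by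
  simp only [pow_mul]
  have hy : 0 ≤ x ^ 2 := sq_nonneg x
  generalize x ^ 2 = y at hy
  have h1 : 0 ≤ y ^ a := by positivity
  have h2 : 0 ≤ y ^ c := by positivity
  rcases le_total y 1 with h | h
  · have := pow_le_pow_of_le_one hy h hab
    linarith
  · have := pow_le_pow_right₀ h hbc
    linarith

lemma arith (E N Q M4 M40 M6 M62 M8 a1 a2 : ℝ) (hE1 : 1 ≤ E) (hN0 : 0 ≤ N) (c1 : 0 ≤ a1)
    (c2 : 0 ≤ a2) (w0 : 0 ≤ M4) (w3 : 0 ≤ Q) (v0 : Q + M4 = E * N)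
    (v1' : M6 ≤ E * M4 + a1 * N) (v2' : M8 ≤ E * M62 + a2 * M40)
    (i1 : M40 ≤ N + M4) (i2 : M62 ≤ N + M6) :
    Q + (2 * E ^ 2 * M40 + 2 * M8) ≤ (9 + 2 * a1 + 4 * a2) * E ^ 3 * N := by
  have hE2 : 1 ≤ E ^ 2 := one_le_pow₀ hE1
  have hE0 : 0 ≤ E := by linarith
  have hEN : N ≤ E * N := by nlinarith
  have hEN2 : E * N ≤ E ^ 2 * N := by nlinarith [mul_le_mul_of_nonneg_left hEN hE0]
  have hEN3 : E ^ 2 * N ≤ E ^ 3 * N := by nlinarith [mul_le_mul_of_nonneg_left hEN2 hE0]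
  have k4 : M4 ≤ E * N := by linarith
  have k40 : M40 ≤ 2 * (E * N) := by linarith
  have kQ : Q ≤ E ^ 3 * N := by linarith
  have k6 : M6 ≤ (1 + a1) * (E ^ 2 * N) := by
    nlinarith [mul_le_mul_of_nonneg_left k4 hE0,
      mul_le_mul_of_nonneg_left (hEN.trans hEN2) c1]
  have k62 : M62 ≤ (2 + a1) * (E ^ 2 * N) := by linarith
  have k8 : M8 ≤ (2 + a1 + 2 * a2) * (E ^ 3 * N) := by
    have x1 := mul_le_mul_of_nonneg_left k62 hE0
    have x2 := mul_le_mul_of_nonneg_left k40 c2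
    have x3 := mul_le_mul_of_nonneg_left (hEN2.trans hEN3) c2
    linarith
  have k40' : E ^ 2 * M40 ≤ 2 * (E ^ 3 * N) := by
    have := mul_le_mul_of_nonneg_left k40 (by positivity : 0 ≤ E ^ 2)
    linarith
  linarith

set_option maxHeartbeats 1000000 in
open Polynomial in
lemma main_bound (n : ℕ) (E : ℝ) (hE1 : 1 ≤ E) (p : ℝ[X])
    (hp : derivative (derivative p) - 2 * X ^ (2 * n + 1) * derivative p
      + C (E - (2 * n + 1)) * X ^ (2 * n) * p = 0) (t : ℝ) :
    ((derivative p - X ^ (2 * n + 1) * p).eval t * ex n t) ^ 2 ≤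
      (9 + 2 * ((n + 1) * (2 * n + 1)) + 4 * ((2 * n + 1) * (4 * n + 1))) * E ^ 3
        * II n (X ^ (2 * n) * p ^ 2) := by
  have ev : ∀ (m : ℕ) (x : ℝ), 0 ≤ x ^ (2 * m) := fun m x => by rw [pow_mul]; positivity
  set q := derivative p - X ^ (2 * n + 1) * p with hq
  set N := II n (X ^ (2 * n) * p ^ 2) with hN
  have hN0 : 0 ≤ N := II_nonneg n _ fun x => by
    have := ev n x
    simp only [eval_mul, eval_pow, eval_X]; positivity
  -- virials
  have v0 := virial n E p 1 hp
  have v1 := virial n E p (X ^ (2 * n + 2)) hp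
  have v2 := virial n E p (X ^ (4 * n + 2)) hp
  have d1 : derivative (derivative (X ^ (2 * n + 2) : ℝ[X])) * p ^ 2
      = C ((2 * n + 2) * (2 * n + 1) : ℝ) * (X ^ (2 * n) * p ^ 2) := by
    simp only [derivative_pow, derivative_mul, derivative_X, derivative_one, derivative_natCast,
      show 2 * n + 2 - 1 = 2 * n + 1 by omega, Nat.add_sub_cancel,
      map_add, map_mul, map_ofNat, map_natCast, map_one]
    push_cast
    ring
  have d2 : derivative (derivative (X ^ (4 * n + 2) : ℝ[X])) * p ^ 2
      = C ((4 * n + 2) * (4 * n + 1) : ℝ) * (X ^ (4 * n) * p ^ 2) := by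
    simp only [derivative_pow, derivative_mul, derivative_X, derivative_one, derivative_natCast,
      show 4 * n + 2 - 1 = 4 * n + 1 by omega, Nat.add_sub_cancel,
      map_add, map_mul, map_ofNat, map_natCast, map_one]
    push_cast
    ring
  rw [d1, II_smul] at v1
  rw [d2, II_smul] at v2
  simp only [derivative_one, derivative_zero, zero_mul, one_mul] at v0
  have z : II n 0 = 0 := by simp [II]
  rw [z] at v0
  rw [← pow_add] at v1 v2
  rw [show (X ^ (2 * n + 2) : ℝ[X]) * X ^ (2 * n) = X ^ (4 * n + 2) by ring] at v1
  rw [show (X ^ (4 * n + 2) : ℝ[X]) * X ^ (2 * n) = X ^ (6 * n + 2) by ring] at v2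
  rw [← hN] at v0 v1
  rw [← hq] at v0 v1 v2
  have w1 : 0 ≤ II n (X ^ (2 * n + 2) * q ^ 2) := II_nonneg n _ fun x => by
    have := ev (n + 1) x
    rw [show 2 * (n + 1) = 2 * n + 2 by ring] at this
    simp only [eval_mul, eval_pow, eval_X]; positivity
  have w2 : 0 ≤ II n (X ^ (4 * n + 2) * q ^ 2) := II_nonneg n _ fun x => by
    have := ev (2 * n + 1) x
    rw [show 2 * (2 * n + 1) = 4 * n + 2 by ring] at this
    simp only [eval_mul, eval_pow, eval_X]; positivity
  have w0 : 0 ≤ II n (X ^ (4 * n + 2) * p ^ 2) := II_nonneg n _ fun x => by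
    have := ev (2 * n + 1) x
    rw [show 2 * (2 * n + 1) = 4 * n + 2 by ring] at this
    simp only [eval_mul, eval_pow, eval_X]; positivity
  have w3 : 0 ≤ II n (q ^ 2) := II_nonneg n _ fun x => by
    simp only [eval_pow]; positivity
  have i1 : II n (X ^ (4 * n) * p ^ 2) ≤ N + II n (X ^ (4 * n + 2) * p ^ 2) := by
    rw [hN, ← II_add]
    refine II_mono n _ _ fun x => ?_
    have := even_pow_le n (2 * n) (2 * n + 1) 0 (by omega) (by omega) x
    rw [show 2 * (2 * n) = 4 * n by ring, show 2 * (2 * n + 1) = 4 * n + 2 by ring] at this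
    simp only [eval_add, eval_mul, eval_pow, eval_X]
    nlinarith [sq_nonneg (p.eval x)]
  have i2 : II n (X ^ (6 * n + 2) * p ^ 2)
      ≤ N + II n (X ^ (2 * n + 2 + (4 * n + 2)) * p ^ 2) := by
    rw [hN, ← II_add]
    refine II_mono n _ _ fun x => ?_
    have := even_pow_le n (3 * n + 1) (3 * n + 2) 0 (by omega) (by omega) x
    rw [show 2 * (3 * n + 1) = 6 * n + 2 by ring,
      show 2 * (3 * n + 2) = 2 * n + 2 + (4 * n + 2) by ring] at this
    simp only [eval_add, eval_mul, eval_pow, eval_X]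
    nlinarith [sq_nonneg (p.eval x)]
  -- the sup bound
  have s := sup_bound n (q ^ 2) (q ^ 2 + (C (2 * E ^ 2) * (X ^ (4 * n) * p ^ 2)
      + C 2 * (X ^ (4 * n + 2 + (4 * n + 2)) * p ^ 2))) (fun x => by
      have e : derivative (q ^ 2) - 2 * X ^ (2 * n + 1) * q ^ 2
          = 2 * q * (X ^ (4 * n + 2) * p - C E * (X ^ (2 * n) * p)) := by
        have hE : C E = C (E - (2 * n + 1)) + (2 * (n : ℝ[X]) + 1) := by
          simp only [map_sub, map_add, map_mul, map_ofNat, map_natCast, map_one]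
          ring
        have hq' : derivative q = derivative (derivative p)
            - (2 * (n : ℝ[X]) + 1) * X ^ (2 * n) * p - X ^ (2 * n + 1) * derivative p := by
          rw [hq]
          simp only [derivative_sub, derivative_mul, derivative_pow, derivative_X]
          push_cast
          simp only [map_add, map_mul, map_ofNat, map_natCast, map_one, Nat.add_sub_cancel]
          ring
        have hp2 := congrArg (fun z => 2 * q * z) hp
        simp only [mul_zero] at hp2
        rw [derivative_pow, hq', hE]
        norm_num
        simp only [map_sub, map_add, map_mul, map_ofNat, map_natCast, map_one] at hp2 hE ⊢
        rw [hq] at hp2 ⊢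
        linear_combination hp2
      rw [e]
      simp only [eval_add, eval_sub, eval_mul, eval_pow, eval_X, eval_C, eval_ofNat]
      generalize q.eval x = a
      generalize p.eval x = b
      have e1 : x ^ (4 * n + 2 + (4 * n + 2)) * b ^ 2 = (x ^ (4 * n + 2) * b) ^ 2 := by ring
      have e2 : x ^ (4 * n) * b ^ 2 = (x ^ (2 * n) * b) ^ 2 := by ring
      rw [e1, e2]
      generalize x ^ (4 * n + 2) * b = c
      generalize x ^ (2 * n) * b = d
      nlinarith [sq_nonneg (a - (c - E * d)), sq_nonneg (c + E * d)]) (fun x => by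
      have h1 := ev (2 * n) x
      have h2 := ev (4 * n + 2) x
      rw [show 2 * (2 * n) = 4 * n by ring] at h1
      rw [show 2 * (4 * n + 2) = 4 * n + 2 + (4 * n + 2) by ring] at h2
      simp only [eval_add, eval_mul, eval_pow, eval_X, eval_C]
      positivity) t
  rw [II_add, II_add, II_smul, II_smul] at s
  rw [mul_pow, ← eval_pow]
  refine s.trans ?_
  generalize II n (X ^ (4 * n + 2 + (4 * n + 2)) * p ^ 2) = M8 at *
  generalize II n (X ^ (2 * n + 2 + (4 * n + 2)) * p ^ 2) = M6 at *
  generalize II n (X ^ (6 * n + 2) * p ^ 2) = M62 at *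
  generalize II n (X ^ (4 * n + 2) * p ^ 2) = M4 at *
  generalize II n (X ^ (4 * n) * p ^ 2) = M40 at *
  generalize II n (q ^ 2) = Q at *
  clear_value N
  have c1 : (0 : ℝ) ≤ (n + 1) * (2 * n + 1) := by positivity
  have c2 : (0 : ℝ) ≤ (2 * n + 1) * (4 * n + 1) := by positivity
  have v1' : M6 ≤ E * M4 + (n + 1) * (2 * n + 1) * N := by nlinarith
  have v2' : M8 ≤ E * M62 + (2 * n + 1) * (4 * n + 1) * M40 := by nlinarith
  exact arith E N Q M4 M40 M6 M62 M8 _ _ hE1 hN0 c1 c2 w0 w3 (by linarith) v1' v2' i1 i2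

lemma final_bound (n : ℕ) (hn : 0 < n) (E : ℝ) (hE1 : 1 ≤ E) (p : Polynomial ℝ)
    (hp : Polynomial.derivative (Polynomial.derivative p)
      - 2 * Polynomial.X ^ (2 * n + 1) * Polynomial.derivative p
      + Polynomial.C (E - (2 * n + 1)) * Polynomial.X ^ (2 * n) * p = 0)
    (u : ℝ → ℝ) (hu : ∀ t, u t = p.eval t * ex n t) (t : ℝ) :
    |deriv (fun t => u t / Real.sqrt (∫ s : ℝ, s ^ (2 * n) * (u s) ^ 2)) t| ≤
      (9 + 2 * ((n + 1) * (2 * n + 1)) + 4 * ((2 * n + 1) * (4 * n + 1)))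
        * E ^ ((7 : ℝ) / 2 - 1 / (4 * (n : ℝ) + 4)) := by
  have hu' : u = fun t => p.eval t * ex n t := funext hu
  have hI : (∫ s : ℝ, s ^ (2 * n) * (u s) ^ 2) = II n (Polynomial.X ^ (2 * n) * p ^ 2) := by
    unfold II
    congr 1
    ext s
    rw [hu]
    simp
    ring
  have hb := main_bound n E hE1 p hp t
  rw [hI]
  set N := II n (Polynomial.X ^ (2 * n) * p ^ 2)
  have hd : HasDerivAt u _ t := hu' ▸ pe_hasDeriv n p t
  rw [(hd.div_const _).deriv]
  set D := (Polynomial.derivative p - Polynomial.X ^ (2 * n + 1) * p).eval t * ex n t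
  set K : ℝ := (9 + 2 * ((n + 1) * (2 * n + 1)) + 4 * ((2 * n + 1) * (4 * n + 1))) with hK
  have hK1 : 1 ≤ K := by
    have : (0 : ℝ) ≤ n := by positivity
    rw [hK]; nlinarith
  have hpow : E ^ (2 : ℕ) ≤ E ^ ((7 : ℝ) / 2 - 1 / (4 * (n : ℝ) + 4)) := by
    rw [← Real.rpow_natCast]
    apply Real.rpow_le_rpow_of_exponent_le hE1
    have : 1 / (4 * (n : ℝ) + 4) ≤ 1 := by
      rw [div_le_one (by positivity)]
      have : (0 : ℝ) ≤ n := by positivity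
      linarith
    push_cast
    linarith
  refine le_trans ?_ (mul_le_mul_of_nonneg_left hpow (by linarith))
  rcases le_or_gt N 0 with h | h
  · rw [Real.sqrt_eq_zero_of_nonpos h]
    simp; positivity
  · apply abs_le_of_sq_le_sq _ (by positivity)
    rw [div_pow, Real.sq_sqrt h.le, div_le_iff₀ h]
    refine hb.trans (mul_le_mul_of_nonneg_right ?_ h.le)
    have h3 : E ^ 3 ≤ E ^ 4 := pow_le_pow_right₀ hE1 (by norm_num)
    have h4 : 0 ≤ E ^ 3 := by positivity
    calc K * E ^ 3 ≤ K * E ^ 4 := by nlinarith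
      _ ≤ K ^ 2 * E ^ 4 := by
        refine mul_le_mul_of_nonneg_right ?_ (by positivity)
        nlinarith
      _ = _ := by ring

open Polynomial in
/-- Laguerre polynomial as a formal polynomial. -/
noncomputable def lagP (a : ℝ) (k : ℕ) : ℝ[X] :=
  ∑ i ∈ Finset.range (k + 1),
    monomial i ((-1 : ℝ) ^ i * genBinom ((k : ℝ) + a) (k - i) / (Nat.factorial i : ℝ))

lemma lagP_eval (a : ℝ) (k : ℕ) (s : ℝ) : (lagP a k).eval s = laguerre a k s := by
  unfold lagP laguerre
  rw [Polynomial.eval_finsetSum]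
  refine Finset.sum_congr rfl fun i _ => ?_
  rw [Polynomial.eval_monomial]
  ring

lemma lagP_coeff (a : ℝ) (k i : ℕ) : (lagP a k).coeff i = if i ≤ k then
    ((-1 : ℝ) ^ i * genBinom ((k : ℝ) + a) (k - i) / (Nat.factorial i : ℝ)) else 0 := by
  unfold lagP
  rw [Polynomial.finsetSum_coeff]
  simp [Polynomial.coeff_monomial, Nat.lt_succ_iff]

lemma lagP_rec (a : ℝ) (k i : ℕ) : (lagP a k).coeff (i + 1) * ((i + 1) * (i + 1 + a))
    + (k - i) * (lagP a k).coeff i = 0 := by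
  rw [lagP_coeff, lagP_coeff]
  rcases lt_trichotomy i k with h | h | h
  · obtain ⟨j, rfl⟩ : ∃ j, k = i + 1 + j := ⟨k - (i + 1), by omega⟩
    rw [if_pos (by omega), if_pos (by omega), show i + 1 + j - (i + 1) = j by omega,
      show i + 1 + j - i = j + 1 by omega]
    unfold genBinom
    rw [Finset.prod_range_succ, Nat.factorial_succ, Nat.factorial_succ, pow_succ]
    have h1 : (Nat.factorial i : ℝ) ≠ 0 := by positivity
    have h2 : (Nat.factorial j : ℝ) ≠ 0 := by positivity
    have h3 : (j : ℝ) + 1 ≠ 0 := by positivity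
    have h4 : (i : ℝ) + 1 ≠ 0 := by positivity
    push_cast
    field_simp
    ring
  · subst h
    simp
  · rw [if_neg (by omega), if_neg (by omega)]
    simp

open Polynomial in
lemma lagP_ode (a : ℝ) (k : ℕ) : X * derivative (derivative (lagP a k))
    + (C (a + 1) - X) * derivative (lagP a k) + C (k : ℝ) * lagP a k = 0 := by
  ext i
  have h := lagP_rec a k i
  rw [sub_mul]
  simp only [coeff_add, coeff_sub, coeff_C_mul, coeff_zero]
  rcases i with _ | i
  · simp only [coeff_X_mul_zero, coeff_derivative]
    push_cast at h ⊢
    linear_combination h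
  · simp only [coeff_X_mul, coeff_derivative]
    push_cast at h ⊢
    linear_combination h

open Polynomial in
lemma ode_even (n k : ℕ) (p : ℝ[X])
    (hp : p = (lagP (-(1 / (2 * (n : ℝ) + 2))) k).comp (C (1 / ((n : ℝ) + 1)) * X ^ (2 * n + 2))) :
    derivative (derivative p) - 2 * X ^ (2 * n + 1) * derivative p
      + C ((4 * (k : ℝ) * ((n : ℝ) + 1) + 2 * (n : ℝ) + 1) - (2 * n + 1)) * X ^ (2 * n) * p = 0 := by
  subst hp
  have o := congrArg (fun z => z.comp (C (1 / ((n : ℝ) + 1)) * X ^ (2 * n + 2)))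
    (lagP_ode (-(1 / (2 * (n : ℝ) + 2))) k)
  have hs : derivative (C (1 / ((n : ℝ) + 1)) * X ^ (2 * n + 2)) = 2 * X ^ (2 * n + 1) := by
    rw [derivative_C_mul_X_pow, ← C_ofNat, show 2 * n + 2 - 1 = 2 * n + 1 by omega]
    congr 2
    push_cast
    field_simp
  have hs2 : derivative (2 * X ^ (2 * n + 1) : ℝ[X]) = C (2 * (2 * n + 1) : ℝ) * X ^ (2 * n) := by
    rw [← C_ofNat, derivative_C_mul_X_pow]
    push_cast
    simp
  have hc : C (1 / ((n : ℝ) + 1)) * C ((n : ℝ) + 1) = 1 := by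
    rw [← C_mul, ← C_1]
    congr 1
    field_simp
  have hd : C (-(1 / (2 * (n : ℝ) + 2)) + 1) * (4 * C ((n : ℝ) + 1)) = C (2 * (2 * n + 1) : ℝ) := by
    rw [← C_ofNat, ← C_mul, ← C_mul]
    congr 1
    field_simp
    ring
  have he : C ((4 * (k : ℝ) * ((n : ℝ) + 1) + 2 * (n : ℝ) + 1) - (2 * n + 1))
      = 4 * C ((n : ℝ) + 1) * C (k : ℝ) := by
    rw [← C_ofNat, ← C_mul, ← C_mul]
    congr 1
    ring
  generalize lagP (-(1 / (2 * (n : ℝ) + 2))) k = L at *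
  simp only [add_comp, sub_comp, mul_comp, X_comp, C_comp, zero_comp] at o
  simp only [derivative_comp, derivative_mul, hs, hs2, he]
  generalize (derivative (derivative L)).comp _ = L2 at *
  generalize (derivative L).comp _ = L1 at *
  generalize L.comp _ = L0 at *
  generalize C (1 / ((n : ℝ) + 1)) = c at *
  generalize C ((n : ℝ) + 1) = c' at *
  generalize C (-(1 / (2 * (n : ℝ) + 2)) + 1) = d at *
  generalize C (2 * (2 * n + 1) : ℝ) = d' at *
  linear_combination 4 * c' * X ^ (2 * n) * o - 4 * X ^ (4 * n + 2) * (L2 - L1) * hc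
    - X ^ (2 * n) * L1 * hd

open Polynomial in
lemma ode_odd (n k : ℕ) (p : ℝ[X])
    (hp : p = X * (lagP (1 / (2 * (n : ℝ) + 2)) k).comp (C (1 / ((n : ℝ) + 1)) * X ^ (2 * n + 2))) :
    derivative (derivative p) - 2 * X ^ (2 * n + 1) * derivative p
      + C ((4 * (k : ℝ) * ((n : ℝ) + 1) + 2 * (n : ℝ) + 3) - (2 * n + 1)) * X ^ (2 * n) * p = 0 := by
  subst hp
  have o := congrArg (fun z => z.comp (C (1 / ((n : ℝ) + 1)) * X ^ (2 * n + 2)))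
    (lagP_ode (1 / (2 * (n : ℝ) + 2)) k)
  have hs : derivative (C (1 / ((n : ℝ) + 1)) * X ^ (2 * n + 2)) = 2 * X ^ (2 * n + 1) := by
    rw [derivative_C_mul_X_pow, ← C_ofNat, show 2 * n + 2 - 1 = 2 * n + 1 by omega]
    congr 2
    push_cast
    field_simp
  have hs2 : derivative (2 * X ^ (2 * n + 1) : ℝ[X]) = C (2 * (2 * n + 1) : ℝ) * X ^ (2 * n) := by
    rw [← C_ofNat, derivative_C_mul_X_pow]
    push_cast
    simp
  have hc : C (1 / ((n : ℝ) + 1)) * C ((n : ℝ) + 1) = 1 := by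
    rw [← C_mul, ← C_1]
    congr 1
    field_simp
  have hd : C (1 / (2 * (n : ℝ) + 2) + 1) * (4 * C ((n : ℝ) + 1))
      = C (2 * (2 * n + 1) : ℝ) + 4 := by
    rw [← C_ofNat, ← C_mul, ← C_mul, ← C_add]
    congr 1
    field_simp
    ring
  have he : C ((4 * (k : ℝ) * ((n : ℝ) + 1) + 2 * (n : ℝ) + 3) - (2 * n + 1))
      = 4 * C ((n : ℝ) + 1) * C (k : ℝ) + 2 := by
    rw [← C_ofNat, ← C_ofNat, ← C_mul, ← C_mul, ← C_add]
    congr 1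
    ring
  generalize lagP (1 / (2 * (n : ℝ) + 2)) k = L at *
  simp only [add_comp, sub_comp, mul_comp, X_comp, C_comp, zero_comp] at o
  simp only [derivative_comp, derivative_mul, derivative_add, derivative_X, derivative_one,
    hs, hs2, he]
  generalize (derivative (derivative L)).comp _ = L2 at *
  generalize (derivative L).comp _ = L1 at *
  generalize L.comp _ = L0 at *
  generalize C (1 / ((n : ℝ) + 1)) = c at *
  generalize C ((n : ℝ) + 1) = c' at *
  generalize C (1 / (2 * (n : ℝ) + 2) + 1) = d at *
  generalize C (2 * (2 * n + 1) : ℝ) = d' at *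
  linear_combination 4 * c' * X ^ (2 * n + 1) * o - 4 * X ^ (4 * n + 3) * (L2 - L1) * hc
    - X ^ (2 * n + 1) * L1 * hd

theorem stmt_6 (n : ℕ) (hn : 0 < n) :
    ∃ C₁ : ℝ, 0 < C₁ ∧ ∀ k : ℕ,
      (∀ t : ℝ,
        |deriv (nvk n k) t| ≤
          C₁ * (4 * (k : ℝ) * ((n : ℝ) + 1) + 2 * (n : ℝ) + 1) ^
            ((7 : ℝ) / 2 - 1 / (4 * (n : ℝ) + 4))) ∧
      (∀ t : ℝ,
        |deriv (nwk n k) t| ≤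
          C₁ * (4 * (k : ℝ) * ((n : ℝ) + 1) + 2 * (n : ℝ) + 3) ^
            ((7 : ℝ) / 2 - 1 / (4 * (n : ℝ) + 4))) := by
  refine ⟨9 + 2 * ((n + 1) * (2 * n + 1)) + 4 * ((2 * n + 1) * (4 * n + 1)), by positivity,
    fun k => ⟨fun t => ?_, fun t => ?_⟩⟩
  · refine final_bound n hn _ ?_ _ (ode_even n k _ rfl) (vk n k) (fun t => ?_) t
    · have : (0 : ℝ) ≤ 4 * (k : ℝ) * ((n : ℝ) + 1) + 2 * (n : ℝ) := by positivity
      linarith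
    · rw [Polynomial.eval_comp, lagP_eval]
      simp only [Polynomial.eval_mul, Polynomial.eval_C, Polynomial.eval_pow, Polynomial.eval_X]
      unfold vk ex
      rw [mul_comm, one_div_mul_eq_div]
  · refine final_bound n hn _ ?_ _ (ode_odd n k _ rfl) (wk n k) (fun t => ?_) t
    · have : (0 : ℝ) ≤ 4 * (k : ℝ) * ((n : ℝ) + 1) + 2 * (n : ℝ) := by positivity
      linarith
    · rw [Polynomial.eval_mul, Polynomial.eval_comp, lagP_eval]
      simp only [Polynomial.eval_mul, Polynomial.eval_C, Polynomial.eval_pow, Polynomial.eval_X]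
      unfold wk ex
      rw [one_div_mul_eq_div]
      ring
end

section
/- Let B > 0 and C₀ > 0 be constants, independent of k, such that |v_k(t)| ≤ C₀^{k+1} e^{-B t^{2n+2}} for all t ∈ ℝ and k ∈ ℤ₊. Then for every B' with 0 < B' < B there exists a constant C₁ > 0, independent of k and satisfying C₁ = O((B - B')^{-2}), such that |v_k'(t)| ≤ C₁ C₀^{k} e^{-B' t^{2n+2}} for all t ∈ ℝ and all k ∈ ℤ₊. -/
open MeasureTheory

open Polynomial in
noncomputable def lagPoly (a : ℝ) (k : ℕ) : ℝ[X] :=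
  ∑ i ∈ Finset.range (k + 1),
    C ((-1 : ℝ) ^ i * genBinom ((k : ℝ) + a) (k - i) / (Nat.factorial i : ℝ)) * X ^ i

theorem lagPoly_eval (a : ℝ) (k : ℕ) (s : ℝ) : (lagPoly a k).eval s = laguerre a k s := by
  unfold lagPoly laguerre
  rw [Polynomial.eval_finsetSum]
  refine Finset.sum_congr rfl fun i _ => ?_
  simp
  ring

theorem lagPoly_coeff (a : ℝ) (k i : ℕ) : (lagPoly a k).coeff i =
    if i ≤ k then (-1 : ℝ) ^ i * genBinom ((k : ℝ) + a) (k - i) / (Nat.factorial i : ℝ) else 0 := by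
  unfold lagPoly
  rw [Polynomial.finsetSum_coeff]
  simp only [Polynomial.coeff_C_mul_X_pow]
  rw [Finset.sum_ite_eq]
  simp

theorem genBinom_succ (a : ℝ) (j : ℕ) : genBinom a (j + 1) * (j + 1) = genBinom a j * (a - j) := by
  unfold genBinom
  rw [Finset.prod_range_succ, Nat.factorial_succ]
  push_cast
  have : (Nat.factorial j : ℝ) ≠ 0 := by positivity
  have : (j : ℝ) + 1 ≠ 0 := by positivity
  field_simp

theorem lagPoly_rec (a : ℝ) (k i : ℕ) :
    ((i : ℝ) + 1) * (i + a + 1) * (lagPoly a k).coeff (i + 1) + (k - i) * (lagPoly a k).coeff i = 0 := by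
  rw [lagPoly_coeff, lagPoly_coeff]
  rcases lt_trichotomy i k with h | h | h
  · obtain ⟨j, rfl⟩ := Nat.exists_eq_add_of_lt h
    have e1 : i + j + 1 - i = j + 1 := by omega
    have e2 : i + j + 1 - (i + 1) = j := by omega
    rw [if_pos (by omega), if_pos (by omega), e1, e2, Nat.factorial_succ]
    have := genBinom_succ (((i + j + 1 : ℕ) : ℝ) + a) j
    have h1 : (Nat.factorial i : ℝ) ≠ 0 := by positivity
    have h2 : (i : ℝ) + 1 ≠ 0 := by positivity
    push_cast at this ⊢
    field_simp
    rw [pow_succ]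
    linear_combination ((-1 : ℝ) ^ i) * this
  · subst h
    simp
  · rw [if_neg (by omega), if_neg (by omega)]; simp

open Polynomial in
theorem lagPoly_ode (a : ℝ) (k : ℕ) :
    X * derivative (derivative (lagPoly a k)) + (C (a + 1) - X) * derivative (lagPoly a k)
      + C (k : ℝ) * lagPoly a k = 0 := by
  ext i
  rw [sub_mul]
  have := lagPoly_rec a k i
  cases i with
  | zero =>
    simp only [coeff_add, coeff_sub, coeff_C_mul, coeff_X_mul_zero, coeff_derivative, coeff_zero]
    simp only [Nat.cast_zero] at *
    linear_combination this
  | succ i =>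
    simp only [coeff_add, coeff_sub, coeff_C_mul, coeff_X_mul, coeff_derivative, coeff_zero]
    push_cast at *
    linear_combination this

theorem lagPoly_ode_eval (a : ℝ) (k : ℕ) (x : ℝ) :
    x * (lagPoly a k).derivative.derivative.eval x + (a + 1 - x) * (lagPoly a k).derivative.eval x
      + k * (lagPoly a k).eval x = 0 := by
  have := congrArg (Polynomial.eval x) (lagPoly_ode a k)
  simpa using this

theorem genBinom_ne (a : ℝ) (ha : -1 < a) (k : ℕ) : genBinom ((k : ℝ) + a) k ≠ 0 := by
  unfold genBinom
  refine div_ne_zero (Finset.prod_ne_zero_iff.2 fun i hi => ?_) (by positivity)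
  have : (i : ℝ) + 1 ≤ k := by exact_mod_cast Finset.mem_range.1 hi
  intro h
  linarith

/-- Gaussian-type integrability. -/
theorem int_poly (n : ℕ) (c : ℝ) (hc : 0 < c) (P : Polynomial ℝ) :
    Integrable (fun t : ℝ => P.eval t * Real.exp (-c * t ^ (2 * n + 2))) := by
  induction P using Polynomial.induction_on' with
  | add p q hp hq =>
    simp only [Polynomial.eval_add, add_mul]
    exact hp.add hq
  | monomial j a =>
    have h1 := integrable_rpow_mul_exp_neg_mul_sq hc (s := (j : ℝ))
      (by have : (0 : ℝ) ≤ j := by positivity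
          linarith)
    simp only [Real.rpow_natCast] at h1
    refine (h1.norm.const_mul (|a| * Real.exp c)).mono' (by fun_prop) ?_
    refine Filter.Eventually.of_forall fun t => ?_
    simp only [Polynomial.eval_monomial, norm_mul, Real.norm_eq_abs, Real.abs_exp]
    have h2 : t ^ 2 ≤ t ^ (2 * n + 2) + 1 := by
      have e : t ^ (2 * n + 2) = (t ^ 2) ^ (n + 1) := by rw [← pow_mul]; ring_nf
      rw [e]
      rcases le_total (t ^ 2) 1 with h | h
      · have : 0 ≤ (t ^ 2) ^ (n + 1) := by positivity
        linarith
      · have := le_self_pow₀ h (Nat.succ_ne_zero n)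
        simp only [Nat.succ_eq_add_one] at this
        linarith
    have h3 : Real.exp (-c * t ^ (2 * n + 2)) ≤ Real.exp c * Real.exp (-c * t ^ 2) := by
      rw [← Real.exp_add, Real.exp_le_exp]
      nlinarith
    calc |a| * |t ^ j| * Real.exp (-c * t ^ (2 * n + 2))
        ≤ |a| * |t ^ j| * (Real.exp c * Real.exp (-c * t ^ 2)) := by gcongr
      _ = _ := by ring

/-- packaged data for an eigenfunction -/
structure EigData (n : ℕ) (E : ℝ) (v v' : ℝ → ℝ) : Prop where
  hd : ∀ t, HasDerivAt v (v' t) t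
  hd' : ∀ t, HasDerivAt v' ((t ^ (4 * n + 2) - E * t ^ (2 * n)) * v t) t
  hv : ∃ Q : Polynomial ℝ, ∀ t, v t = Q.eval t * Real.exp (-(1 / (2 * n + 2)) * t ^ (2 * n + 2))
  hv' : ∃ Q : Polynomial ℝ, ∀ t, v' t = Q.eval t * Real.exp (-(1 / (2 * n + 2)) * t ^ (2 * n + 2))
  even : ∀ t, v (-t) = v t

theorem EigData.smul {n : ℕ} {E : ℝ} {v v' : ℝ → ℝ} (h : EigData n E v v') (c : ℝ) :
    EigData n E (fun t => v t / c) (fun t => v' t / c) where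
  hd t := (h.hd t).div_const c
  hd' t := by
    have := (h.hd' t).div_const c
    rwa [mul_div_assoc] at this
  hv := by
    obtain ⟨Q, hQ⟩ := h.hv
    exact ⟨Polynomial.C (1 / c) * Q, fun t => by simp [hQ]; ring⟩
  hv' := by
    obtain ⟨Q, hQ⟩ := h.hv'
    exact ⟨Polynomial.C (1 / c) * Q, fun t => by simp [hQ]; ring⟩
  even t := by simp only [h.even]

theorem vk_eig (n k : ℕ) : ∃ v', EigData n (4 * k * (n + 1) + 2 * n + 1) (vk n k) v' := by
  set a : ℝ := -(1 / (2 * (n : ℝ) + 2)) with ha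
  have hn1 : (n : ℝ) + 1 ≠ 0 := by positivity
  have hn2 : 2 * (n : ℝ) + 2 ≠ 0 := by positivity
  have hx : ∀ t : ℝ, HasDerivAt (fun t : ℝ => t ^ (2 * n + 2) / ((n : ℝ) + 1)) (2 * t ^ (2 * n + 1)) t := by
    intro t
    have := (hasDerivAt_pow (2 * n + 2) t).div_const ((n : ℝ) + 1)
    convert! this using 1
    push_cast
    field_simp
  have he : ∀ t : ℝ, HasDerivAt (fun t : ℝ => Real.exp (-(t ^ (2 * n + 2)) / (2 * (n : ℝ) + 2)))
      (Real.exp (-(t ^ (2 * n + 2)) / (2 * (n : ℝ) + 2)) * (-t ^ (2 * n + 1))) t := by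
    intro t
    refine HasDerivAt.exp ?_
    have := (hx t).const_mul (-1 / 2)
    convert! this using 1
    · funext t; field_simp
    · ring
  have hP : ∀ (P : Polynomial ℝ) (t : ℝ), HasDerivAt (fun t : ℝ => P.eval (t ^ (2 * n + 2) / ((n : ℝ) + 1)))
      (P.derivative.eval (t ^ (2 * n + 2) / ((n : ℝ) + 1)) * (2 * t ^ (2 * n + 1))) t := by
    intro P t
    exact (P.hasDerivAt _).comp t (hx t)
  have hv : vk n k = fun t => Real.exp (-(t ^ (2 * n + 2)) / (2 * (n : ℝ) + 2)) *
      (lagPoly a k).eval (t ^ (2 * n + 2) / ((n : ℝ) + 1)) := by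
    funext t; rw [lagPoly_eval]; rfl
  have hg : ∀ t : ℝ, Real.exp (-(t ^ (2 * n + 2)) / (2 * (n : ℝ) + 2)) =
      Real.exp (-(1 / (2 * n + 2)) * t ^ (2 * n + 2)) := by
    intro t; congr 1; field_simp
  set L := lagPoly a k with hL
  set M : Polynomial ℝ := L.derivative - Polynomial.C (1 / 2) * L with hM
  refine ⟨fun t => Real.exp (-(t ^ (2 * n + 2)) / (2 * (n : ℝ) + 2)) *
    (2 * t ^ (2 * n + 1) * M.eval (t ^ (2 * n + 2) / ((n : ℝ) + 1))), ?_, ?_, ?_, ?_, ?_⟩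
  · intro t
    rw [hv]
    convert! (he t).mul (hP L t) using 1
    simp only [hM, Polynomial.eval_sub, Polynomial.eval_mul, Polynomial.eval_C]
    ring
  · intro t
    have hpw : HasDerivAt (fun t : ℝ => 2 * t ^ (2 * n + 1)) (2 * ((2 * n + 1) * t ^ (2 * n))) t := by
      have := (hasDerivAt_pow (2 * n + 1) t).const_mul 2
      convert! this using 1
      push_cast; simp
    convert! (he t).mul (hpw.mul (hP M t)) using 1
    rw [hv]
    have hode := lagPoly_ode_eval a k (t ^ (2 * n + 2) / ((n : ℝ) + 1))
    rw [← hL] at hode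
    have hxt : t ^ (2 * n + 2) = (n + 1) * (t ^ (2 * n + 2) / ((n : ℝ) + 1)) := by field_simp
    simp only [hM, Polynomial.derivative_sub, Polynomial.derivative_mul, Polynomial.derivative_C,
      Polynomial.eval_sub, Polynomial.eval_mul, Polynomial.eval_C, Polynomial.eval_add,
      Polynomial.eval_zero]
    have e1 : t ^ (4 * n + 2) = t ^ (2 * n) * t ^ (2 * n + 2) := by rw [← pow_add]; ring_nf
    have e2 : t ^ (2 * n + 1) * t ^ (2 * n + 1) = t ^ (2 * n) * t ^ (2 * n + 2) := by
      rw [← pow_add, ← pow_add]; ring_nf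
    generalize Real.exp (-(t ^ (2 * n + 2)) / (2 * (n : ℝ) + 2)) = G at *
    rw [e1]
    have ha' : (2 * (n : ℝ) + 2) * a = -1 := by rw [ha]; field_simp
    simp only [Pi.mul_apply]
    generalize t ^ (2 * n + 2) / ((n : ℝ) + 1) = x at *
    generalize Polynomial.eval x L = l0 at *
    generalize Polynomial.eval x L.derivative = l1 at *
    generalize Polynomial.eval x L.derivative.derivative = l2 at *
    generalize t ^ (2 * n + 1) = q at *
    generalize t ^ (2 * n) = r at *
    generalize t ^ (2 * n + 2) = m at *
    have hxx : ((n : ℝ) + 1) * x / (n + 1) = x := by field_simp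
    subst hxt
    try rw [hxx]
    linear_combination (-4 * (n + 1) * G * r) * hode + (2 * G * r * l1) * ha' 
      - (G * (4 * l2 - 4 * l1 + l0)) * e2
  · refine ⟨L.comp (Polynomial.C (1 / ((n : ℝ) + 1)) * Polynomial.X ^ (2 * n + 2)), fun t => ?_⟩
    rw [hv, ← hg]
    simp [Polynomial.eval_comp]
    rw [mul_comm, div_eq_inv_mul (t ^ _)]
  · refine ⟨Polynomial.C 2 * Polynomial.X ^ (2 * n + 1) * M.comp (Polynomial.C (1 / ((n : ℝ) + 1)) * Polynomial.X ^ (2 * n + 2)), fun t => ?_⟩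
    rw [← hg]
    simp only [Polynomial.eval_mul, Polynomial.eval_comp, Polynomial.eval_C, Polynomial.eval_pow,
      Polynomial.eval_X, div_eq_inv_mul (t ^ _), one_div]
    ring
  · intro t
    unfold vk
    rw [Even.neg_pow ⟨n + 1, by ring⟩]

theorem EigData.int1 {n : ℕ} {f : ℝ → ℝ}
    (hf : ∃ Q : Polynomial ℝ, ∀ t, f t = Q.eval t * Real.exp (-(1 / (2 * n + 2)) * t ^ (2 * n + 2)))
    (P : Polynomial ℝ) : Integrable (fun t => P.eval t * f t) := by
  obtain ⟨Q, hQ⟩ := hf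
  have := int_poly n (1 / (2 * n + 2)) (by positivity) (P * Q)
  refine this.congr (Filter.Eventually.of_forall fun t => ?_)
  simp only [hQ, Polynomial.eval_mul]
  ring

theorem EigData.int2 {n : ℕ} {f g : ℝ → ℝ}
    (hf : ∃ Q : Polynomial ℝ, ∀ t, f t = Q.eval t * Real.exp (-(1 / (2 * n + 2)) * t ^ (2 * n + 2)))
    (hg : ∃ Q : Polynomial ℝ, ∀ t, g t = Q.eval t * Real.exp (-(1 / (2 * n + 2)) * t ^ (2 * n + 2)))
    (P : Polynomial ℝ) : Integrable (fun t => P.eval t * (f t * g t)) := by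
  obtain ⟨Q, hQ⟩ := hf
  obtain ⟨R, hR⟩ := hg
  have := int_poly n (2 * (1 / (2 * n + 2))) (by positivity) (P * Q * R)
  refine this.congr (Filter.Eventually.of_forall fun t => ?_)
  have e : Real.exp (-(2 * (1 / (2 * (n : ℝ) + 2))) * t ^ (2 * n + 2)) =
      Real.exp (-(1 / (2 * n + 2)) * t ^ (2 * n + 2)) *
        Real.exp (-(1 / (2 * n + 2)) * t ^ (2 * n + 2)) := by
    rw [← Real.exp_add]; congr 1; ring
  simp only [hQ, hR, Polynomial.eval_mul, e]
  ring

theorem EigData.intpow {n : ℕ} {E : ℝ} {v v' : ℝ → ℝ} (h : EigData n E v v') (j : ℕ) :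
    Integrable (fun t => t ^ j * v t ^ 2) := by
  have := EigData.int2 h.hv h.hv (Polynomial.X ^ j)
  refine this.congr (Filter.Eventually.of_forall fun t => ?_)
  simp [sq]

theorem EigData.virial {n : ℕ} {E : ℝ} {v v' : ℝ → ℝ} (h : EigData n E v v')
    (hnorm : ∫ t : ℝ, t ^ (2 * n) * v t ^ 2 = 1) :
    ∫ t : ℝ, t ^ (4 * n + 2) * v t ^ 2 = E / 2 := by
  have hder : ∀ t, HasDerivAt (fun t => t * (v' t * v' t)
      + (E * t ^ (2 * n + 1) - t ^ (4 * n + 3)) * (v t * v t) - v t * v' t)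
      ((2 * n + 2) * E * (t ^ (2 * n) * v t ^ 2) - (4 * n + 4) * (t ^ (4 * n + 2) * v t ^ 2)) t := by
    intro t
    have h1 := (hasDerivAt_id t).mul ((h.hd' t).mul (h.hd' t))
    have h2 := (((hasDerivAt_pow (2 * n + 1) t).const_mul E).sub (hasDerivAt_pow (4 * n + 3) t)).mul
      ((h.hd t).mul (h.hd t))
    have h3 := (h.hd t).mul (h.hd' t)
    convert! (h1.add h2).sub h3 using 1
    push_cast
    simp only [id, Pi.mul_apply, Pi.sub_apply]
    ring
  have hint' : Integrable (fun t => (2 * n + 2) * E * (t ^ (2 * n) * v t ^ 2)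
      - (4 * n + 4) * (t ^ (4 * n + 2) * v t ^ 2)) :=
    ((h.intpow (2 * n)).const_mul _).sub ((h.intpow (4 * n + 2)).const_mul _)
  have hint : Integrable (fun t => t * (v' t * v' t)
      + (E * t ^ (2 * n + 1) - t ^ (4 * n + 3)) * (v t * v t) - v t * v' t) := by
    have h1 := EigData.int2 h.hv' h.hv' Polynomial.X
    have h2 := EigData.int2 h.hv h.hv
      (Polynomial.C E * Polynomial.X ^ (2 * n + 1) - Polynomial.X ^ (4 * n + 3))
    have h3 := EigData.int2 h.hv h.hv' 1
    refine ((h1.add h2).sub h3).congr (Filter.Eventually.of_forall fun t => ?_)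
    simp
  have := integral_eq_zero_of_hasDerivAt_of_integrable hder hint' hint
  rw [integral_sub ((h.intpow (2 * n)).const_mul _) ((h.intpow (4 * n + 2)).const_mul _),
    integral_const_mul, integral_const_mul, hnorm] at this
  have hp : (4 * (n : ℝ) + 4) ≠ 0 := by positivity
  have := mul_left_cancel₀ hp (a := (4 * (n : ℝ) + 4))
    (b := ∫ t : ℝ, t ^ (4 * n + 2) * v t ^ 2) (c := E / 2) (by linarith)
  exact this

theorem EigData.ftc {f f' : ℝ → ℝ} (hd : ∀ t, HasDerivAt f (f' t) t) (hf : Integrable f)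
    (hf' : Integrable f') (t : ℝ) : f t = ∫ s in Set.Ioi t, -f' s := by
  have h0 := tendsto_zero_of_hasDerivAt_of_integrableOn_Ioi (a := t) (fun x _ => hd x)
    hf'.integrableOn hf.integrableOn
  have := integral_Ioi_of_hasDerivAt_of_tendsto' (a := t) (fun x _ => hd x) hf'.integrableOn h0
  rw [integral_neg, this]
  ring

theorem EigData.energy {n : ℕ} {E : ℝ} (hE : 0 ≤ E) {v v' : ℝ → ℝ} (h : EigData n E v v')
    (hnorm : ∫ t : ℝ, t ^ (2 * n) * v t ^ 2 = 1) (t : ℝ) (ht : 0 ≤ t) (htE : t ^ (2 * n + 2) ≤ E) :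
    v' t ^ 2 ≤ (4 * n + 2) * (1 + E / 2) := by
  have hder : ∀ t, HasDerivAt (fun t => (v' t * v' t)
      + (E * t ^ (2 * n) - t ^ (4 * n + 2)) * (v t * v t))
      ((E * (2 * n * t ^ (2 * n - 1)) - (4 * n + 2) * t ^ (4 * n + 1)) * (v t * v t)) t := by
    intro t
    have h1 := ((h.hd' t).mul (h.hd' t))
    have h2 := (((hasDerivAt_pow (2 * n) t).const_mul E).sub (hasDerivAt_pow (4 * n + 2) t)).mul
      ((h.hd t).mul (h.hd t))
    convert! (h1.add h2) using 1
    push_cast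
    simp only [Pi.mul_apply, Pi.sub_apply]
    ring
  have hint' : Integrable (fun t =>
      (E * (2 * n * t ^ (2 * n - 1)) - (4 * n + 2) * t ^ (4 * n + 1)) * (v t * v t)) := by
    refine (EigData.int2 h.hv h.hv (Polynomial.C (E * (2 * n)) * Polynomial.X ^ (2 * n - 1)
      - Polynomial.C (4 * n + 2 : ℝ) * Polynomial.X ^ (4 * n + 1))).congr
        (Filter.Eventually.of_forall fun t => ?_)
    simp only [Polynomial.eval_sub, Polynomial.eval_mul, Polynomial.eval_C, Polynomial.eval_pow,
      Polynomial.eval_X]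
    ring
  have hint : Integrable (fun t => (v' t * v' t)
      + (E * t ^ (2 * n) - t ^ (4 * n + 2)) * (v t * v t)) := by
    have h1 := EigData.int2 h.hv' h.hv' 1
    have h2 := EigData.int2 h.hv h.hv
      (Polynomial.C E * Polynomial.X ^ (2 * n) - Polynomial.X ^ (4 * n + 2))
    refine (h1.add h2).congr (Filter.Eventually.of_forall fun t => ?_)
    simp
  have key := EigData.ftc hder hint hint' t
  have hI := ((h.intpow (2 * n)).add (h.intpow (4 * n + 2))).const_mul (4 * (n : ℝ) + 2)
  have b1 : (∫ s in Set.Ioi t,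
      -((E * (2 * n * s ^ (2 * n - 1)) - (4 * n + 2) * s ^ (4 * n + 1)) * (v s * v s)))
      ≤ ∫ s in Set.Ioi t, (4 * (n : ℝ) + 2) * (s ^ (2 * n) * v s ^ 2 + s ^ (4 * n + 2) * v s ^ 2) := by
    refine setIntegral_mono_on hint'.neg.integrableOn hI.integrableOn measurableSet_Ioi ?_
    intro s hs
    have hs0 : 0 ≤ s := ht.trans (le_of_lt hs)
    have p : s ^ (4 * n + 1) ≤ s ^ (2 * n) + s ^ (4 * n + 2) := by
      rcases le_total s 1 with h1 | h1
      · have := pow_le_pow_of_le_one hs0 h1 (show 2 * n ≤ 4 * n + 1 by omega)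
        have : 0 ≤ s ^ (4 * n + 2) := by positivity
        linarith
      · have := pow_le_pow_right₀ h1 (show 4 * n + 1 ≤ 4 * n + 2 by omega)
        have : 0 ≤ s ^ (2 * n) := by positivity
        linarith
    have q : 0 ≤ E * (2 * n * s ^ (2 * n - 1)) * (v s ^ 2) := by positivity
    have r : (4 * (n : ℝ) + 2) * v s ^ 2 * s ^ (4 * n + 1) ≤
      (4 * (n : ℝ) + 2) * v s ^ 2 * (s ^ (2 * n) + s ^ (4 * n + 2)) := by gcongr
    nlinarith
  have b2 : (∫ s in Set.Ioi t, (4 * (n : ℝ) + 2) * (s ^ (2 * n) * v s ^ 2 + s ^ (4 * n + 2) * v s ^ 2))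
      ≤ ∫ s, (4 * (n : ℝ) + 2) * (s ^ (2 * n) * v s ^ 2 + s ^ (4 * n + 2) * v s ^ 2) := by
    refine setIntegral_le_integral hI (Filter.Eventually.of_forall fun s => ?_)
    have e1 : 0 ≤ s ^ (2 * n) := Even.pow_nonneg ⟨n, by ring⟩ s
    have e2 : 0 ≤ s ^ (4 * n + 2) := Even.pow_nonneg ⟨2 * n + 1, by ring⟩ s
    simp only [Pi.zero_apply]
    positivity
  have b3 : (∫ s, (4 * (n : ℝ) + 2) * (s ^ (2 * n) * v s ^ 2 + s ^ (4 * n + 2) * v s ^ 2))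
      = (4 * n + 2) * (1 + E / 2) := by
    rw [integral_const_mul, integral_add (h.intpow (2 * n)) (h.intpow (4 * n + 2)), hnorm,
      h.virial hnorm]
  have e : t ^ (4 * n + 2) = t ^ (2 * n) * t ^ (2 * n + 2) := by rw [← pow_add]; ring_nf
  have c1 : 0 ≤ (E * t ^ (2 * n) - t ^ (4 * n + 2)) * (v t * v t) := by
    rw [e]
    have : 0 ≤ t ^ (2 * n) * (E - t ^ (2 * n + 2)) * (v t ^ 2) := by
      have : 0 ≤ E - t ^ (2 * n + 2) := by linarith
      positivity
    nlinarith
  nlinarith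

theorem J_bound (n j : ℕ) (hj : j ≤ 4 * n + 2) (B : ℝ) (hB : 0 < B) : ∃ K : ℝ, 0 ≤ K ∧ ∀ δ, 0 < δ → δ < B →
    (∫ s in Set.Ioi (0 : ℝ), s ^ j * Real.exp (-δ * s ^ (2 * n + 2))) ≤ K / δ ^ 2 := by
  set p : ℝ := ((j : ℝ) + 1) / (2 * n + 2) with hp
  have hp2 : p ≤ 2 := by
    rw [hp, div_le_iff₀ (by positivity)]
    have : (j : ℝ) ≤ 4 * n + 2 := by exact_mod_cast hj
    linarith
  have hp0 : 0 < p := by positivity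
  have hG := Real.Gamma_pos_of_pos hp0
  refine ⟨B ^ (2 - p) * (1 / (2 * n + 2)) * Real.Gamma p, by positivity, fun δ hδ hδB => ?_⟩
  have h := integral_rpow_mul_exp_neg_mul_rpow (p := ((2 * n + 2 : ℕ) : ℝ)) (q := (j : ℝ)) (b := δ)
    (by positivity) (by have : (0 : ℝ) ≤ j := by positivity
                        linarith) hδ
  simp only [Real.rpow_natCast] at h
  rw [h, le_div_iff₀ (by positivity)]
  push_cast
  rw [neg_div, ← hp]
  have : δ ^ (-p) * δ ^ 2 ≤ B ^ (2 - p) := by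
    rw [← Real.rpow_natCast δ 2, ← Real.rpow_add hδ]
    have e : -p + ((2 : ℕ) : ℝ) = 2 - p := by push_cast; ring
    rw [e]
    exact Real.rpow_le_rpow hδ.le hδB.le (by linarith)
  calc _ = (δ ^ (-p) * δ ^ 2) * ((1 / (2 * n + 2)) * Real.Gamma p) := by ring
    _ ≤ B ^ (2 - p) * ((1 / (2 * n + 2)) * Real.Gamma p) := by gcongr
    _ = _ := by ring

theorem EigData.large {n : ℕ} {E : ℝ} (hE : 0 ≤ E) {v v' : ℝ → ℝ} (h : EigData n E v v')
    (A B B' D : ℝ) (hA : 0 ≤ A) (hB' : 0 < B') (hBB : B' < B)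
    (hbd : ∀ t, |v t| ≤ A * Real.exp (-B * t ^ (2 * n + 2))) (t : ℝ) (ht : 0 ≤ t) (hD : 1 ≤ D)
    (htE : E ≤ D * (1 + t ^ (2 * n + 2))) :
    |v' t| ≤ A * (2 * D) * Real.exp (-B' * t ^ (2 * n + 2)) *
      ((∫ s in Set.Ioi (0 : ℝ), s ^ (2 * n) * Real.exp (-(B - B') * s ^ (2 * n + 2))) +
      ∫ s in Set.Ioi (0 : ℝ), s ^ (4 * n + 2) * Real.exp (-(B - B') * s ^ (2 * n + 2))) := by
  have hint' : Integrable (fun t => (t ^ (4 * n + 2) - E * t ^ (2 * n)) * v t) := by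
    refine (EigData.int1 h.hv (Polynomial.X ^ (4 * n + 2)
      - Polynomial.C E * Polynomial.X ^ (2 * n))).congr (Filter.Eventually.of_forall fun t => ?_)
    simp
  have hint : Integrable v' := by
    refine (EigData.int1 h.hv' 1).congr (Filter.Eventually.of_forall fun t => ?_)
    simp
  have hJ : ∀ j : ℕ, Integrable (fun s : ℝ => s ^ j * Real.exp (-(B - B') * s ^ (2 * n + 2))) := by
    intro j
    refine (int_poly n (B - B') (by linarith) (Polynomial.X ^ j)).congr
      (Filter.Eventually.of_forall fun t => ?_)
    simp
  rw [EigData.ftc h.hd' hint hint' t, ← Real.norm_eq_abs]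
  refine (norm_integral_le_integral_norm _).trans ?_
  have hI := ((hJ (2 * n)).add (hJ (4 * n + 2))).const_mul
    (A * (2 * D) * Real.exp (-B' * t ^ (2 * n + 2)))
  rw [← integral_add (hJ (2 * n)).integrableOn (hJ (4 * n + 2)).integrableOn, ← integral_const_mul]
  refine le_trans (setIntegral_mono_on hint'.neg.norm.integrableOn hI.integrableOn measurableSet_Ioi ?_)
    (setIntegral_mono_set hI.integrableOn ?_ (Set.Ioi_subset_Ioi ht).eventuallyLE)
  · intro s hs
    have hs' : t ≤ s := le_of_lt hs
    have hs0 : 0 ≤ s := ht.trans hs'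
    have hts : t ^ (2 * n + 2) ≤ s ^ (2 * n + 2) := by gcongr
    have e : s ^ (4 * n + 2) = s ^ (2 * n) * s ^ (2 * n + 2) := by rw [← pow_add]; ring_nf
    have c1 : |s ^ (4 * n + 2) - E * s ^ (2 * n)| ≤ 2 * D * (s ^ (2 * n) + s ^ (4 * n + 2)) := by
      have x1 : 0 ≤ s ^ (2 * n) := by positivity
      have x2 : 0 ≤ s ^ (2 * n + 2) := by positivity
      have x3 : E * s ^ (2 * n) ≤ D * (1 + s ^ (2 * n + 2)) * s ^ (2 * n) := by
        gcongr
        refine htE.trans ?_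
        gcongr
      have x4 : 0 ≤ E * s ^ (2 * n) := by positivity
      have x5 : 0 ≤ s ^ (2 * n) * s ^ (2 * n + 2) := by positivity
      have x6 : 0 ≤ D * s ^ (2 * n) := by positivity
      have x7 : s ^ (2 * n) * s ^ (2 * n + 2) ≤ D * (s ^ (2 * n) * s ^ (2 * n + 2)) :=
        le_mul_of_one_le_left x5 hD
      rw [e, abs_le]
      constructor <;> nlinarith
    have c2 : Real.exp (-B * s ^ (2 * n + 2)) ≤
        Real.exp (-B' * t ^ (2 * n + 2)) * Real.exp (-(B - B') * s ^ (2 * n + 2)) := by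
      rw [← Real.exp_add, Real.exp_le_exp]
      nlinarith
    have c3 : |v s| ≤ A * (Real.exp (-B' * t ^ (2 * n + 2)) * Real.exp (-(B - B') * s ^ (2 * n + 2))) :=
      (hbd s).trans (by gcongr)
    simp only [norm_neg, norm_mul, Real.norm_eq_abs]
    have c4 := mul_le_mul c1 c3 (abs_nonneg _) (by positivity)
    refine c4.trans (le_of_eq ?_)
    simp only [Pi.add_apply]
    ring
  · refine Filter.Eventually.of_forall fun s => ?_
    have e1 : 0 ≤ s ^ (2 * n) := Even.pow_nonneg ⟨n, by ring⟩ s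
    have e2 : 0 ≤ s ^ (4 * n + 2) := Even.pow_nonneg ⟨2 * n + 1, by ring⟩ s
    simp only [Pi.zero_apply, Pi.add_apply]
    positivity

theorem vk_norm_pos (n k : ℕ) : 0 < ∫ s : ℝ, s ^ (2 * n) * (vk n k s) ^ 2 := by
  obtain ⟨v', h⟩ := vk_eig n k
  have hc : Continuous (vk n k) := continuous_iff_continuousAt.2 fun t => (h.hd t).continuousAt
  have h0 : vk n k 0 ≠ 0 := by
    have e : vk n k 0 = genBinom ((k : ℝ) + -(1 / (2 * (n : ℝ) + 2))) k := by
      unfold vk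
      rw [← lagPoly_eval]
      have := Polynomial.coeff_zero_eq_eval_zero (lagPoly (-(1 / (2 * (n : ℝ) + 2))) k)
      rw [lagPoly_coeff] at this
      simp at this ⊢
      rw [← this]
    rw [e]
    apply genBinom_ne
    rw [neg_lt_neg_iff, div_lt_one (by positivity)]
    have : (0 : ℝ) ≤ n := by positivity
    linarith
  rw [integral_pos_iff_support_of_nonneg _ (h.intpow (2 * n))]
  · have hopen : IsOpen (Function.support (fun s : ℝ => s ^ (2 * n) * (vk n k s) ^ 2)) :=
      Continuous.isOpen_support (by fun_prop)
    refine hopen.measure_pos _ ?_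
    have hev : ∀ᶠ s in nhdsWithin (0 : ℝ) {0}ᶜ, vk n k s ≠ 0 ∧ s ≠ 0 := by
      refine Filter.Eventually.and ?_ self_mem_nhdsWithin
      exact nhdsWithin_le_nhds (hc.continuousAt.eventually_ne h0)
    obtain ⟨s, h1, h2⟩ := hev.exists
    refine ⟨s, ?_⟩
    rw [Function.mem_support]
    positivity
  · intro s
    have e1 : 0 ≤ s ^ (2 * n) := Even.pow_nonneg ⟨n, by ring⟩ s
    simp only [Pi.zero_apply]
    positivity

theorem nvk_eig (n k : ℕ) : ∃ v', EigData n (4 * k * (n + 1) + 2 * n + 1) (nvk n k) v' := by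
  obtain ⟨v', h⟩ := vk_eig n k
  exact ⟨_, h.smul _⟩

theorem nvk_norm (n k : ℕ) : ∫ s : ℝ, s ^ (2 * n) * (nvk n k s) ^ 2 = 1 := by
  have h := vk_norm_pos n k
  have : ∀ s : ℝ, s ^ (2 * n) * (nvk n k s) ^ 2 =
      (s ^ (2 * n) * (vk n k s) ^ 2) / ∫ s : ℝ, s ^ (2 * n) * (vk n k s) ^ 2 := by
    intro s
    unfold nvk
    rw [div_pow, Real.sq_sqrt h.le]
    ring
  simp_rw [this]
  rw [integral_div, div_self h.ne']

theorem C0_gt_one (n : ℕ) (B C₀ : ℝ) (hB : 0 < B) (hC₀ : 0 < C₀)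
    (hbound : ∀ k : ℕ, ∀ t : ℝ,
      |nvk n k t| ≤ C₀ ^ (k + 1) * Real.exp (-B * t ^ (2 * n + 2))) : 1 < C₀ := by
  by_contra hle
  push Not at hle
  set M := ∫ t : ℝ, t ^ (4 * n + 2) * Real.exp (-(2 * B) * t ^ (2 * n + 2)) with hM
  have hMi : Integrable (fun t : ℝ => t ^ (4 * n + 2) * Real.exp (-(2 * B) * t ^ (2 * n + 2))) := by
    refine (int_poly n (2 * B) (by linarith) (Polynomial.X ^ (4 * n + 2))).congr
      (Filter.Eventually.of_forall fun t => ?_)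
    simp
  have hk : ∀ k : ℕ, (4 * (k : ℝ) * (n + 1) + 2 * n + 1) / 2 ≤ M := by
    intro k
    obtain ⟨v', h⟩ := nvk_eig n k
    rw [← h.virial (nvk_norm n k)]
    refine integral_mono (h.intpow _) hMi fun t => ?_
    have e2 : 0 ≤ t ^ (4 * n + 2) := Even.pow_nonneg ⟨2 * n + 1, by ring⟩ t
    have c : |nvk n k t| ≤ Real.exp (-B * t ^ (2 * n + 2)) := by
      refine (hbound k t).trans ?_
      exact mul_le_of_le_one_left (Real.exp_pos _).le (pow_le_one₀ hC₀.le hle)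
    have c' : nvk n k t ^ 2 ≤ Real.exp (-(2 * B) * t ^ (2 * n + 2)) := by
      rw [← sq_abs]
      calc |nvk n k t| ^ 2 ≤ Real.exp (-B * t ^ (2 * n + 2)) ^ 2 := by gcongr
        _ = _ := by rw [← Real.exp_nat_mul]; congr 1; push_cast; ring
    simp only
    gcongr
  obtain ⟨k, hk'⟩ := exists_nat_gt M
  have := hk k
  have hn0 : (0 : ℝ) ≤ n := by positivity
  have hk0 : (0 : ℝ) ≤ k := by positivity
  nlinarith [mul_nonneg hk0 hn0]


set_option maxHeartbeats 1000000

/-- Exponential decay of the derivatives: if `|v_k(t)| ≤ C₀^{k+1} e^{-B t^{2n+2}}`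
for all `k, t`, then for every `0 < B' < B` there is `C₁ > 0`, independent of `k`
and with `C₁ = O((B-B')^{-2})`, such that `|v_k'(t)| ≤ C₁ C₀^k e^{-B' t^{2n+2}}`. -/
theorem stmt_8 (n : ℕ) (hn : 0 < n) (B C₀ : ℝ) (hB : 0 < B) (hC₀ : 0 < C₀)
    (hbound : ∀ k : ℕ, ∀ t : ℝ,
      |nvk n k t| ≤ C₀ ^ (k + 1) * Real.exp (-B * t ^ (2 * n + 2))) :
    ∃ K : ℝ, 0 < K ∧ ∀ B' : ℝ, 0 < B' → B' < B →
      ∃ C₁ : ℝ, 0 < C₁ ∧ C₁ ≤ K / (B - B') ^ 2 ∧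
        ∀ k : ℕ, ∀ t : ℝ,
          |deriv (nvk n k) t| ≤ C₁ * C₀ ^ k * Real.exp (-B' * t ^ (2 * n + 2)) := by
  have hC1 := C0_gt_one n B C₀ hB hC₀ hbound
  set ℓ := Real.log C₀ / 2 with hℓ
  have hℓ0 : 0 < ℓ := by have := Real.log_pos hC1; positivity
  have hCk : ∀ k : ℕ, C₀ ^ k = Real.exp (k * ℓ) * Real.exp (k * ℓ) := by
    intro k
    rw [← Real.exp_add, ← Real.exp_log (pow_pos hC₀ k), Real.log_pow]
    congr 1
    rw [hℓ]; ring
  set ε := min 1 (ℓ / B) with hε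
  have hε0 : 0 < ε := lt_min one_pos (by positivity)
  have hε1 : ε ≤ 1 := min_le_left _ _
  have hεB : B * ε ≤ ℓ := by
    have : ε ≤ ℓ / B := min_le_right _ _
    rw [le_div_iff₀ hB] at this
    linarith
  obtain ⟨K1, hK1, hJ1⟩ := J_bound n (2 * n) (by omega) B hB
  obtain ⟨K2, hK2, hJ2⟩ := J_bound n (4 * n + 2) le_rfl B hB
  set D : ℝ := 4 * (n + 1) / ε + 2 * n + 1 with hD
  have hD1 : 1 ≤ D := by
    have : 0 ≤ 4 * ((n : ℝ) + 1) / ε := by positivity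
    have : (0 : ℝ) ≤ n := by positivity
    linarith
  set Cs : ℝ := (4 * n + 2) * (4 * n + 4) * (1 + 1 / ℓ) with hCs
  have hCs0 : 0 < Cs := by positivity
  set KL : ℝ := C₀ * (2 * D) * (K1 + K2) with hKL
  have hKL0 : 0 ≤ KL := by positivity
  have hK0 : 0 < Cs * B ^ 2 + KL := by positivity
  refine ⟨Cs * B ^ 2 + KL, hK0, fun B' hB' hBB => ?_⟩
  have hδ : 0 < B - B' := by linarith
  refine ⟨(Cs * B ^ 2 + KL) / (B - B') ^ 2, by positivity, le_rfl, fun k => ?_⟩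
  obtain ⟨v', h⟩ := nvk_eig n k
  have hder : ∀ t, deriv (nvk n k) t = v' t := fun t => (h.hd t).deriv
  have hn0 : (0 : ℝ) ≤ n := by positivity
  have hk0 : (0 : ℝ) ≤ k := by positivity
  set E : ℝ := 4 * k * (n + 1) + 2 * n + 1 with hE
  have hE0 : 0 ≤ E := by positivity
  have hmain : ∀ t, 0 ≤ t → |v' t| ≤ (Cs * B ^ 2 + KL) / (B - B') ^ 2 * C₀ ^ k *
      Real.exp (-B' * t ^ (2 * n + 2)) := by
    intro t ht
    rcases le_total (t ^ (2 * n + 2)) (ε * k) with hs | hs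
    · have htE : t ^ (2 * n + 2) ≤ E := by
        have : ε * k ≤ k := mul_le_of_le_one_left hk0 hε1
        nlinarith [mul_nonneg hk0 hn0]
      have hen := h.energy hE0 (nvk_norm n k) t ht htE
      have h1 : |v' t| ≤ (4 * n + 2) * (1 + E / 2) := by
        apply abs_le_of_sq_le_sq _ (by positivity)
        refine hen.trans ?_
        apply le_self_pow₀ _ (by norm_num)
        nlinarith [mul_nonneg hn0 hE0]
      have h2 : (1 + E / 2) ≤ (4 * n + 4) * (k + 1) := by
        nlinarith [mul_nonneg hk0 hn0]
      have h3 : (k : ℝ) + 1 ≤ (1 + 1 / ℓ) * Real.exp (k * ℓ) := by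
        have a1 := Real.add_one_le_exp (k * ℓ)
        have a2 : (k : ℝ) ≤ Real.exp (k * ℓ) / ℓ := by
          rw [le_div_iff₀ hℓ0]; linarith
        have a3 : 0 ≤ k * ℓ := by positivity
        calc (k : ℝ) + 1 ≤ Real.exp (k * ℓ) / ℓ + Real.exp (k * ℓ) := by linarith
          _ = _ := by ring
      have h4 : 1 ≤ Real.exp (k * ℓ) * Real.exp (-B' * t ^ (2 * n + 2)) := by
        rw [← Real.exp_add]
        apply Real.one_le_exp
        have b1 : B' * t ^ (2 * n + 2) ≤ B * (ε * k) := by gcongr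
        have b2 : B * ε * k ≤ ℓ * k := by gcongr
        linarith
      have h5 : Cs ≤ (Cs * B ^ 2 + KL) / (B - B') ^ 2 := by
        rw [le_div_iff₀ (by positivity)]
        have : (B - B') ^ 2 ≤ B ^ 2 := by gcongr; linarith
        nlinarith
      calc |v' t| ≤ (4 * n + 2) * (1 + E / 2) := h1
        _ ≤ (4 * n + 2) * ((4 * n + 4) * (k + 1)) := by gcongr
        _ ≤ (4 * n + 2) * ((4 * n + 4) * ((1 + 1 / ℓ) * Real.exp (k * ℓ))) := by gcongr
        _ = Cs * Real.exp (k * ℓ) * 1 := by rw [hCs]; ring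
        _ ≤ Cs * Real.exp (k * ℓ) * (Real.exp (k * ℓ) * Real.exp (-B' * t ^ (2 * n + 2))) := by gcongr
        _ = Cs * C₀ ^ k * Real.exp (-B' * t ^ (2 * n + 2)) := by rw [hCk]; ring
        _ ≤ _ := by gcongr
    · have htE : E ≤ D * (1 + t ^ (2 * n + 2)) := by
        have x0 : 0 ≤ t ^ (2 * n + 2) := by positivity
        have x1 : (k : ℝ) ≤ t ^ (2 * n + 2) / ε := by
          rw [le_div_iff₀ hε0]; linarith
        have x2 : 4 * (n + 1) * (k : ℝ) ≤ 4 * (n + 1) * (t ^ (2 * n + 2) / ε) := by gcongr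
        have x3 : 0 ≤ 4 * ((n : ℝ) + 1) / ε := by positivity
        have x4 : 4 * (n + 1) * (t ^ (2 * n + 2) / ε) = 4 * ((n : ℝ) + 1) / ε * t ^ (2 * n + 2) := by ring
        rw [hE, hD]
        nlinarith [mul_nonneg hn0 x0]
      have hL := h.large hE0 (C₀ ^ (k + 1)) B B' D (by positivity) hB' hBB (hbound k) t ht hD1 htE
      refine hL.trans ?_
      have j1 := hJ1 (B - B') hδ (by linarith)
      have j2 := hJ2 (B - B') hδ (by linarith)
      calc _ ≤ C₀ ^ (k + 1) * (2 * D) * Real.exp (-B' * t ^ (2 * n + 2)) *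
            (K1 / (B - B') ^ 2 + K2 / (B - B') ^ 2) := by gcongr
        _ = KL / (B - B') ^ 2 * C₀ ^ k * Real.exp (-B' * t ^ (2 * n + 2)) := by
          rw [hKL, pow_succ]; ring
        _ ≤ _ := by
          gcongr
          have : 0 ≤ Cs * B ^ 2 := by positivity
          linarith
  intro t
  rw [hder]
  rcases le_total 0 t with ht | ht
  · exact hmain t ht
  · have hm := hmain (-t) (by linarith)
    rw [Even.neg_pow ⟨n + 1, by ring⟩] at hm
    have hodd : v' (-t) = - v' t := by
      have e : (fun s => nvk n k (-s)) = nvk n k := funext h.even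
      have d1 : deriv (fun s => nvk n k (-s)) t = -deriv (nvk n k) (-t) := deriv_comp_neg _ _
      rw [e, hder, hder] at d1
      linarith
    rwa [hodd, abs_neg] at hm
end

section
/- There exists a constant C_v > 0 such that for every k ∈ ℤ₊, every α, β ∈ ℤ₊, and every t ∈ ℝ: |t^α ∂_t^β v_k(t)| ≤ C_v^{k+α+β+1} (α!)^{1/(2n+2)} (β!)^{(2n+1)/(2n+2)}. In particular each v_k belongs to the Gel'fand–Shilov space S^{1/(2n+2)}_{(2n+1)/(2n+2)}(ℝ). -/
open MeasureTheory

lemma gsh_add_pow_le (m : ℕ) : ∃ K : ℝ, 1 ≤ K ∧ ∀ x y : ℝ, 0 ≤ x → 0 ≤ y →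
    (x + y) ^ m ≤ 3 / 2 * x ^ m + K * y ^ m := by
  obtain ⟨d, hd0, hd⟩ : ∃ d : ℝ, 0 < d ∧ (1 + d) ^ m ≤ 3 / 2 := by
    have hc : Filter.Tendsto (fun d : ℝ => (1 + d) ^ m) (nhdsWithin 0 (Set.Ioi 0)) (nhds 1) := by
      have : ContinuousAt (fun d : ℝ => (1 + d) ^ m) 0 := by fun_prop
      have h2 := this.tendsto
      simp only [add_zero, one_pow] at h2
      exact h2.mono_left nhdsWithin_le_nhds
    have h1 : ∀ᶠ d in nhdsWithin (0 : ℝ) (Set.Ioi 0), (1 + d) ^ m < 3 / 2 :=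
      hc.eventually (gt_mem_nhds (by norm_num))
    obtain ⟨d, h, h'⟩ := (h1.and self_mem_nhdsWithin).exists
    exact ⟨d, h', h.le⟩
  refine ⟨(1 / d + 1) ^ m, one_le_pow₀ (by have : 0 < 1 / d := by positivity
                                           linarith), fun x y hx hy => ?_⟩
  rcases le_total y (d * x) with h | h
  · have h1 : (x + y) ^ m ≤ ((1 + d) * x) ^ m := by
      apply pow_le_pow_left₀ (by positivity); linarith
    rw [mul_pow] at h1
    have h2 : (1 + d) ^ m * x ^ m ≤ 3 / 2 * x ^ m := by gcongr
    have h3 : 0 ≤ (1 / d + 1) ^ m * y ^ m := by positivity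
    linarith
  · have hx' : x ≤ 1 / d * y := by
      rw [one_div, inv_mul_eq_div, le_div_iff₀ hd0]; linarith
    have h1 : (x + y) ^ m ≤ ((1 / d + 1) * y) ^ m := by
      apply pow_le_pow_left₀ (by positivity); linarith
    rw [mul_pow] at h1
    have h3 : 0 ≤ 3 / 2 * x ^ m := by positivity
    linarith

lemma gsh_norm_pow_sub (m : ℕ) (z w : ℂ) :
    ‖(z + w) ^ m - z ^ m‖ ≤ (‖z‖ + ‖w‖) ^ m - ‖z‖ ^ m := by
  induction m with
  | zero => simp
  | succ m ih =>
    have h1 : (z + w) ^ (m + 1) - z ^ (m + 1)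
        = (z + w) * ((z + w) ^ m - z ^ m) + w * z ^ m := by ring
    rw [h1]
    calc _ ≤ ‖z + w‖ * ‖(z + w) ^ m - z ^ m‖ + ‖w‖ * ‖z‖ ^ m := by
            refine (norm_add_le _ _).trans ?_
            rw [norm_mul, norm_mul, norm_pow]
      _ ≤ (‖z‖ + ‖w‖) * ((‖z‖ + ‖w‖) ^ m - ‖z‖ ^ m) + ‖w‖ * ‖z‖ ^ m := by
            gcongr
            exact norm_add_le _ _
      _ = _ := by ring

lemma gsh_prod_eq (k l : ℕ) (h : l ≤ k) :
    ∏ j ∈ Finset.range l, ((k : ℝ) - j) = (k.descFactorial l : ℝ) := by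
  rw [Nat.descFactorial_eq_prod_range, Nat.cast_prod]
  refine Finset.prod_congr rfl fun j hj => ?_
  rw [Nat.cast_sub]
  have := Finset.mem_range.1 hj
  omega

lemma gsh_genBinom_le (a : ℝ) (ha : -(1 / 2) ≤ a) (ha' : a ≤ 0) (k l : ℕ) (h : l ≤ k) :
    |genBinom ((k : ℝ) + a) l| ≤ 2 ^ k := by
  have hf : (0 : ℝ) < (Nat.factorial l : ℝ) := by positivity
  have hj : ∀ j ∈ Finset.range l, (1 : ℝ) ≤ (k : ℝ) - j := by
    intro j hj
    have : j + 1 ≤ k := by have := Finset.mem_range.1 hj; omega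
    have : (j : ℝ) + 1 ≤ k := by exact_mod_cast this
    linarith
  have h1 : ∏ i ∈ Finset.range l, ((k : ℝ) + a - i) ≤ (k.descFactorial l : ℝ) := by
    rw [← gsh_prod_eq k l h]
    refine Finset.prod_le_prod (fun j h => ?_) (fun j h => ?_)
    · linarith [hj j h]
    · linarith
  have h0 : 0 ≤ ∏ i ∈ Finset.range l, ((k : ℝ) + a - i) := by
    refine Finset.prod_nonneg (fun j h => ?_)
    linarith [hj j h]
  unfold genBinom
  rw [abs_of_nonneg (by positivity), div_le_iff₀ hf]
  refine h1.trans ?_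
  rw [Nat.descFactorial_eq_factorial_mul_choose]
  have : (k.choose l : ℝ) ≤ 2 ^ k := by exact_mod_cast Nat.choose_le_two_pow k l
  push_cast
  rw [mul_comm]
  gcongr

lemma gsh_genBinom_ge (a : ℝ) (ha : -(1 / 2) ≤ a) (k : ℕ) :
    (1 / 2) ^ k ≤ genBinom ((k : ℝ) + a) k := by
  have hf : (0 : ℝ) < (Nat.factorial k : ℝ) := by positivity
  have hj : ∀ j ∈ Finset.range k, (1 : ℝ) ≤ (k : ℝ) - j := by
    intro j hj
    have : j + 1 ≤ k := by have := Finset.mem_range.1 hj; omega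
    have : (j : ℝ) + 1 ≤ k := by exact_mod_cast this
    linarith
  unfold genBinom
  rw [le_div_iff₀ hf, ← Nat.descFactorial_self, ← gsh_prod_eq k k le_rfl]
  calc (1 / 2 : ℝ) ^ k * ∏ j ∈ Finset.range k, ((k : ℝ) - j)
      = ∏ j ∈ Finset.range k, (1 / 2 * ((k : ℝ) - j)) := by
        rw [Finset.prod_mul_distrib]; simp
    _ ≤ _ := by
      refine Finset.prod_le_prod (fun j h => ?_) (fun j h => ?_)
      · linarith [hj j h]
      · linarith [hj j h]

/-- complex Laguerre polynomial -/
noncomputable def gshLag (a : ℝ) (k : ℕ) (s : ℂ) : ℂ :=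
  ∑ i ∈ Finset.range (k + 1),
    (((-1 : ℝ) ^ i * genBinom ((k : ℝ) + a) (k - i) / (Nat.factorial i : ℝ) : ℝ) : ℂ) * s ^ i

lemma gsh_lag_ofReal (a : ℝ) (k : ℕ) (s : ℝ) : gshLag a k (s : ℂ) = (laguerre a k s : ℂ) := by
  unfold gshLag laguerre
  rw [Complex.ofReal_sum]
  refine Finset.sum_congr rfl fun i _ => ?_
  push_cast
  ring

lemma gsh_lag_norm (a : ℝ) (ha : -(1 / 2) ≤ a) (ha' : a ≤ 0) (k : ℕ) (s : ℂ) :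
    ‖gshLag a k s‖ ≤ 24 ^ k * Real.exp (1 / 12 * ‖s‖) := by
  unfold gshLag
  refine (norm_sum_le _ _).trans ?_
  have hterm : ∀ i ∈ Finset.range (k + 1),
      ‖(((-1 : ℝ) ^ i * genBinom ((k : ℝ) + a) (k - i) / (Nat.factorial i : ℝ) : ℝ) : ℂ) * s ^ i‖
        ≤ 24 ^ k * ((1 / 12 * ‖s‖) ^ i / (Nat.factorial i : ℝ)) := by
    intro i hi
    have hik : i ≤ k := by have := Finset.mem_range.1 hi; omega
    rw [norm_mul, Complex.norm_real, norm_pow, Real.norm_eq_abs, abs_div, abs_mul, abs_pow,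
      abs_neg, abs_one, one_pow, one_mul, Nat.abs_cast]
    have h1 := gsh_genBinom_le a ha ha' k (k - i) (Nat.sub_le _ _)
    have h2 : (12 : ℝ) ^ i ≤ 12 ^ k := pow_le_pow_right₀ (by norm_num) hik
    have h3 : |genBinom ((k : ℝ) + a) (k - i)| ≤ 24 ^ k * (1 / 12) ^ i := by
      refine h1.trans ?_
      have : (24 : ℝ) ^ k = 2 ^ k * 12 ^ k := by rw [← mul_pow]; norm_num
      rw [this, one_div, inv_pow, mul_assoc]
      have h4 : (1 : ℝ) ≤ 12 ^ k * (12 ^ i)⁻¹ := by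
        rw [← div_eq_mul_inv, one_le_div (by positivity)]; exact h2
      nlinarith [show (0 : ℝ) < 2 ^ k by positivity]
    calc |genBinom ((k : ℝ) + a) (k - i)| / (Nat.factorial i : ℝ) * ‖s‖ ^ i
        ≤ 24 ^ k * (1 / 12) ^ i / (Nat.factorial i : ℝ) * ‖s‖ ^ i := by gcongr
      _ = _ := by rw [mul_pow]; ring
  refine (Finset.sum_le_sum hterm).trans ?_
  rw [← Finset.mul_sum]
  gcongr
  exact Real.sum_le_exp_of_nonneg (by positivity) _

/-- complex extension of `vk` -/
noncomputable def gshF (n k : ℕ) (z : ℂ) : ℂ :=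
  Complex.exp (-(z ^ (2 * n + 2)) / (2 * (n : ℂ) + 2)) *
    gshLag (-(1 / (2 * (n : ℝ) + 2))) k (z ^ (2 * n + 2) / ((n : ℂ) + 1))

lemma gsh_F_ofReal (n k : ℕ) (t : ℝ) : gshF n k (t : ℂ) = (vk n k t : ℂ) := by
  unfold gshF vk
  rw [Complex.ofReal_mul, ← gsh_lag_ofReal]
  push_cast
  rfl

lemma gsh_F_diff (n k : ℕ) : Differentiable ℂ (gshF n k) := by
  unfold gshF gshLag
  fun_prop

lemma gsh_iter_diff (F : ℂ → ℂ) (hF : Differentiable ℂ F) (b : ℕ) :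
    Differentiable ℂ (iteratedDeriv b F) :=
  (hF.contDiff (n := ⊤)).differentiable_iteratedDeriv b (by exact_mod_cast WithTop.coe_lt_top _)

lemma gsh_iter_re (F : ℂ → ℂ) (hF : Differentiable ℂ F) (b : ℕ) :
    iteratedDeriv b (fun t : ℝ => (F t).re) = fun t : ℝ => (iteratedDeriv b F t).re := by
  induction b with
  | zero => simp
  | succ b ih =>
    rw [iteratedDeriv_succ, ih]
    funext t
    rw [iteratedDeriv_succ]
    exact ((gsh_iter_diff F hF b (t : ℂ)).hasDerivAt.real_of_complex).deriv

lemma gsh_vk_eq (n k : ℕ) : vk n k = fun t : ℝ => (gshF n k t).re := by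
  funext t
  rw [gsh_F_ofReal, Complex.ofReal_re]

lemma gsh_F_norm (n k : ℕ) (K : ℝ) (hK : ∀ x y : ℝ, 0 ≤ x → 0 ≤ y →
    (x + y) ^ (2 * n + 2) ≤ 3 / 2 * x ^ (2 * n + 2) + K * y ^ (2 * n + 2)) (t : ℝ) (w : ℂ) :
    ‖gshF n k (t + w)‖ ≤ 24 ^ k * (Real.exp (2 * K / (2 * n + 2) * ‖w‖ ^ (2 * n + 2)) *
      Real.exp (-(t ^ (2 * n + 2) / (4 * (2 * n + 2))))) := by
  have hev : |t| ^ (2 * n + 2) = t ^ (2 * n + 2) := Even.pow_abs ⟨n + 1, by ring⟩ t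
  have hn0 : (0 : ℝ) < 2 * n + 2 := by positivity
  have h1 := gsh_norm_pow_sub (2 * n + 2) (t : ℂ) w
  have h2 := hK |t| ‖w‖ (abs_nonneg _) (norm_nonneg _)
  rw [Complex.norm_real, Real.norm_eq_abs] at h1
  rw [hev] at h1 h2
  have h3 : ‖((t : ℂ) + w) ^ (2 * n + 2)‖ ≤ 3 / 2 * t ^ (2 * n + 2) + K * ‖w‖ ^ (2 * n + 2) := by
    rw [norm_pow]
    refine le_trans (pow_le_pow_left₀ (norm_nonneg _) ?_ _) h2
    refine (norm_add_le _ _).trans ?_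
    rw [Complex.norm_real, Real.norm_eq_abs]
  have h4 : t ^ (2 * n + 2) / 2 - K * ‖w‖ ^ (2 * n + 2) ≤ (((t : ℂ) + w) ^ (2 * n + 2)).re := by
    have h5 := (Complex.abs_re_le_norm _).trans h1
    rw [Complex.sub_re, ← Complex.ofReal_pow, Complex.ofReal_re] at h5
    have := (abs_le.1 h5).1
    linarith
  unfold gshF
  rw [norm_mul, Complex.norm_exp]
  have ha : -(1 / 2) ≤ -(1 / (2 * (n : ℝ) + 2)) := by
    rw [neg_le_neg_iff]
    apply one_div_le_one_div_of_le (by norm_num)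
    have : (0 : ℝ) ≤ n := by positivity
    linarith
  have ha' : -(1 / (2 * (n : ℝ) + 2)) ≤ 0 := by
    rw [neg_nonpos]; positivity
  have h6 := gsh_lag_norm _ ha ha' k (((t : ℂ) + w) ^ (2 * n + 2) / ((n : ℂ) + 1))
  refine (mul_le_mul_of_nonneg_left h6 (Real.exp_nonneg _)).trans ?_
  rw [mul_left_comm, ← Real.exp_add, ← Real.exp_add]
  refine mul_le_mul_of_nonneg_left (Real.exp_le_exp.2 ?_) (by positivity)
  have e1 : (-(((t : ℂ) + w) ^ (2 * n + 2)) / (2 * (n : ℂ) + 2)).re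
      = -(((t : ℂ) + w) ^ (2 * n + 2)).re / (2 * n + 2) := by
    rw [show (2 * (n : ℂ) + 2) = ((2 * n + 2 : ℝ) : ℂ) by push_cast; rfl, Complex.div_ofReal_re,
      Complex.neg_re]
  have e2 : ‖((t : ℂ) + w) ^ (2 * n + 2) / ((n : ℂ) + 1)‖
      = ‖((t : ℂ) + w) ^ (2 * n + 2)‖ / (n + 1) := by
    rw [norm_div, show ((n : ℂ) + 1) = ((n + 1 : ℝ) : ℂ) by push_cast; rfl, Complex.norm_real,
      Real.norm_of_nonneg (by positivity)]
  rw [e1, e2]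
  set R := (((t : ℂ) + w) ^ (2 * n + 2)).re
  set N := ‖((t : ℂ) + w) ^ (2 * n + 2)‖
  set T := t ^ (2 * n + 2)
  set W := ‖w‖ ^ (2 * n + 2)
  have hW : 0 ≤ K * W := by
    have := hK 0 ‖w‖ le_rfl (norm_nonneg _)
    rw [zero_add, zero_pow (by omega), mul_zero, zero_add] at this
    exact le_trans (by positivity) this
  have e3 : -R / (2 * n + 2) + 1 / 12 * (N / (n + 1)) = (-R + N / 6) / (2 * n + 2) := by
    field_simp; ring
  have e4 : 2 * K / (2 * n + 2) * W + -(T / (4 * (2 * n + 2)))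
      = (2 * (K * W) - T / 4) / (2 * n + 2) := by
    field_simp; ring
  rw [e3, e4]
  gcongr ?_ / _
  linarith

lemma gsh_fact_pow (m a : ℕ) (hm : 0 < m) (t : ℝ) (hev : Even m) :
    |t| ^ a * Real.exp (-(t ^ m / (4 * m))) ≤ 4 ^ a * (Nat.factorial a : ℝ) ^ ((1 : ℝ) / m) := by
  have hm0 : (0 : ℝ) < m := by exact_mod_cast hm
  have hT : 0 ≤ t ^ m := hev.pow_nonneg t
  have h1 : (t ^ m / 4) ^ a / (Nat.factorial a : ℝ) ≤ Real.exp (t ^ m / 4) :=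
    Real.pow_div_factorial_le_exp _ (by positivity) a
  have hf : (0 : ℝ) < (Nat.factorial a : ℝ) := by positivity
  rw [div_le_iff₀ hf] at h1
  have h2 := Real.rpow_le_rpow (by positivity) h1 (show (0 : ℝ) ≤ 1 / m by positivity)
  rw [Real.mul_rpow (by positivity) (by positivity), ← Real.exp_mul, div_pow,
    Real.div_rpow (by positivity) (by positivity)] at h2
  have h3 : ((t ^ m) ^ a) ^ ((1 : ℝ) / m) = |t| ^ a := by
    rw [← hev.pow_abs, ← pow_mul, mul_comm m a, pow_mul, one_div,
      Real.pow_rpow_inv_natCast (by positivity) hm.ne']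
  have h4 : ((4 : ℝ) ^ a) ^ ((1 : ℝ) / m) ≤ 4 ^ a := by
    have : (1 : ℝ) / m ≤ 1 := by
      rw [div_le_one hm0]; exact_mod_cast hm
    calc ((4 : ℝ) ^ a) ^ ((1 : ℝ) / m) ≤ ((4 : ℝ) ^ a) ^ (1 : ℝ) :=
          Real.rpow_le_rpow_of_exponent_le (one_le_pow₀ (by norm_num)) this
      _ = _ := Real.rpow_one _
  rw [h3, div_le_iff₀ (by positivity)] at h2
  rw [Real.exp_neg, ← div_eq_mul_inv, div_le_iff₀ (Real.exp_pos _)]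
  have e : t ^ m / 4 * (1 / m) = t ^ m / (4 * m) := by field_simp
  rw [e] at h2
  refine h2.trans ?_
  calc _ ≤ Real.exp (t ^ m / (4 * m)) * (Nat.factorial a : ℝ) ^ ((1 : ℝ) / m) * 4 ^ a := by gcongr
    _ = _ := by ring

lemma gsh_unnorm (n : ℕ) : ∃ D : ℝ, 2 ≤ D ∧ ∀ k a b : ℕ, ∀ t : ℝ,
      |t ^ a * iteratedDeriv b (vk n k) t| ≤
        D ^ (k + a + b + 1) *
          (Nat.factorial a : ℝ) ^ ((1 : ℝ) / (2 * (n : ℝ) + 2)) *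
          (Nat.factorial b : ℝ) ^ ((2 * (n : ℝ) + 1) / (2 * (n : ℝ) + 2)) := by
  obtain ⟨K, hK1, hK⟩ := gsh_add_pow_le (2 * n + 2)
  have hn0 : (0 : ℝ) < 2 * n + 2 := by positivity
  set E := Real.exp (2 * K / (2 * n + 2)) with hE
  have hE1 : 1 ≤ E := Real.one_le_exp (by positivity)
  refine ⟨24 * E, by linarith, fun k a b t => ?_⟩
  set r : ℝ := ((b : ℝ) + 1) ^ ((1 : ℝ) / (2 * n + 2)) with hr
  have hr0 : 0 < r := by positivity
  have hcast : ((2 * n + 2 : ℕ) : ℝ) = 2 * n + 2 := by push_cast; rfl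
  have hrm : r ^ (2 * n + 2) = (b : ℝ) + 1 := by
    rw [hr, ← hcast, one_div, Real.rpow_inv_natCast_pow (by positivity) (by omega)]
  have hrb : (Nat.factorial b : ℝ) ^ ((1 : ℝ) / (2 * n + 2)) ≤ r ^ b := by
    rw [hr, ← Real.rpow_natCast, ← Real.rpow_mul (by positivity), mul_comm _ (b : ℝ),
      Real.rpow_mul (by positivity), Real.rpow_natCast]
    gcongr
    have h1 : (Nat.factorial b : ℝ) ≤ (b : ℝ) ^ b := by exact_mod_cast Nat.factorial_le_pow b
    refine h1.trans ?_
    gcongr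
    linarith
  set M := 24 ^ k * (Real.exp (2 * K / (2 * n + 2) * (b + 1)) *
      Real.exp (-(t ^ (2 * n + 2) / (4 * (2 * n + 2))))) with hM
  have hC : ‖iteratedDeriv b (gshF n k) t‖ ≤ Nat.factorial b * M / r ^ b := by
    refine Complex.norm_iteratedDeriv_le_of_forall_mem_sphere_norm_le b hr0
      (gsh_F_diff n k).diffContOnCl ?_
    intro z hz
    have h := gsh_F_norm n k K hK t (z - t)
    rw [mem_sphere_iff_norm] at hz
    rw [hz, hrm, add_sub_cancel] at h
    exact h
  have hfac : (Nat.factorial b : ℝ) / r ^ b ≤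
      (Nat.factorial b : ℝ) ^ ((2 * (n : ℝ) + 1) / (2 * (n : ℝ) + 2)) := by
    have hb : (0 : ℝ) < (Nat.factorial b : ℝ) := by positivity
    rw [div_le_iff₀ (by positivity)]
    calc (Nat.factorial b : ℝ) = (Nat.factorial b : ℝ) ^ ((2 * (n : ℝ) + 1) / (2 * (n : ℝ) + 2))
          * (Nat.factorial b : ℝ) ^ ((1 : ℝ) / (2 * n + 2)) := by
          rw [← Real.rpow_add hb, ← add_div,
            show (2 * (n : ℝ) + 1 + 1) = 2 * n + 2 by ring, div_self hn0.ne', Real.rpow_one]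
      _ ≤ _ := by gcongr
  have hEb : Real.exp (2 * K / (2 * n + 2) * (b + 1)) = E ^ (b + 1) := by
    rw [hE, ← Real.exp_nat_mul]; congr 1; push_cast; ring
  have hta := gsh_fact_pow (2 * n + 2) a (by omega) t ⟨n + 1, by ring⟩
  rw [hcast] at hta
  have hv : |iteratedDeriv b (vk n k) t| ≤ Nat.factorial b * M / r ^ b := by
    rw [gsh_vk_eq, gsh_iter_re _ (gsh_F_diff n k)]
    exact (Complex.abs_re_le_norm _).trans hC
  rw [abs_mul, abs_pow]
  set X := Real.exp (-(t ^ (2 * n + 2) / (4 * (2 * n + 2))))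
  set A := (Nat.factorial a : ℝ) ^ ((1 : ℝ) / (2 * (n : ℝ) + 2))
  set B := (Nat.factorial b : ℝ) ^ ((2 * (n : ℝ) + 1) / (2 * (n : ℝ) + 2))
  calc |t| ^ a * |iteratedDeriv b (vk n k) t| ≤ |t| ^ a * (Nat.factorial b * M / r ^ b) := by gcongr
    _ = 24 ^ k * E ^ (b + 1) * (|t| ^ a * X) * (Nat.factorial b / r ^ b) := by
        rw [hM, hEb]; ring
    _ ≤ 24 ^ k * E ^ (b + 1) * (4 ^ a * A) * B := by gcongr
    _ = (24 ^ k * 4 ^ a * E ^ (b + 1)) * A * B := by ring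
    _ ≤ ((24 * E) ^ k * (24 * E) ^ a * (24 * E) ^ (b + 1)) * A * B := by
        gcongr <;> linarith
    _ = _ := by rw [← pow_add, ← pow_add, ← add_assoc]

lemma gsh_vk_contDiff (n k : ℕ) : ContDiff ℝ 1 (vk n k) := by
  unfold vk laguerre
  fun_prop

lemma gsh_vk_zero (n k : ℕ) : (1 / 2) ^ k ≤ vk n k 0 := by
  have ha : -(1 / 2) ≤ -(1 / (2 * (n : ℝ) + 2)) := by
    rw [neg_le_neg_iff]
    apply one_div_le_one_div_of_le (by norm_num)
    have : (0 : ℝ) ≤ n := by positivity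
    linarith
  have h := gsh_genBinom_ge _ ha k
  have : vk n k 0 = genBinom ((k : ℝ) + -(1 / (2 * (n : ℝ) + 2))) k := by
    unfold vk laguerre
    rw [Finset.sum_range_succ']
    simp
  rw [this]; exact h

lemma gsh_integrable (n k : ℕ) : Integrable (fun s : ℝ => s ^ (2 * n) * (vk n k s) ^ 2) := by
  obtain ⟨D, hD, h⟩ := gsh_unnorm n
  have h' : ∀ a, ∃ c, ∀ s : ℝ, |s ^ a * vk n k s| ≤ c := fun a =>
    ⟨_, fun s => by simpa using h k a 0 s⟩
  obtain ⟨c0, h0⟩ := h' 0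
  obtain ⟨c1, h1⟩ := h' (2 * n)
  obtain ⟨c2, h2⟩ := h' (2 * n + 2)
  refine (integrable_inv_one_add_sq.const_mul (c1 * c0 + c2 * c0)).mono'
    (((continuous_id.pow _).mul ((gsh_vk_contDiff n k).continuous.pow 2)).aestronglyMeasurable)
    (Filter.Eventually.of_forall fun s => ?_)
  rw [← div_eq_mul_inv, le_div_iff₀ (by positivity), Real.norm_eq_abs]
  have e : |s ^ (2 * n) * vk n k s ^ 2| * (1 + s ^ 2)
      = |s ^ (2 * n) * vk n k s| * |s ^ 0 * vk n k s|
        + |s ^ (2 * n + 2) * vk n k s| * |s ^ 0 * vk n k s| := by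
    simp only [abs_mul, abs_pow, pow_zero, one_mul]
    rw [← sq_abs s]; ring
  rw [e]
  have hc1 := (abs_nonneg _).trans (h1 0)
  have hc2 := (abs_nonneg _).trans (h2 0)
  gcongr
  · exact h1 s
  · exact h0 s
  · exact h2 s
  · exact h0 s

lemma gsh_norm_lower (n : ℕ) : ∃ H : ℝ, 1 ≤ H ∧ ∀ k : ℕ,
    (Real.sqrt (∫ s : ℝ, s ^ (2 * n) * (vk n k s) ^ 2))⁻¹ ≤ H ^ (k + 1) := by
  obtain ⟨D, hD, h⟩ := gsh_unnorm n
  set H : ℝ := 4 * (2 * n + 1) * (2 * D ^ 2) ^ (2 * n + 1) with hH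
  have hD2 : 1 ≤ 2 * D ^ 2 := by nlinarith
  have hn1 : (1 : ℝ) ≤ 2 * n + 1 := by
    have : (0 : ℝ) ≤ n := by positivity
    linarith
  have hH1 : 1 ≤ H := by
    have := one_le_pow₀ hD2 (n := 2 * n + 1)
    rw [hH]
    nlinarith
  refine ⟨H, hH1, fun k => ?_⟩
  set d : ℝ := (1 / (2 * D ^ 2)) ^ (k + 1) with hd
  have hd0 : 0 < d := by positivity
  have hder : ∀ s : ℝ, ‖deriv (vk n k) s‖ ≤ D ^ (k + 2) := by
    intro s
    have := h k 0 1 s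
    simpa [iteratedDeriv_one] using this
  have hdiff : ∀ s : ℝ, DifferentiableAt ℝ (vk n k) s :=
    fun s => (gsh_vk_contDiff n k).differentiable (by norm_num) s
  have hlow : ∀ s ∈ Set.Icc 0 d, (1 / 2) ^ (k + 1) ≤ vk n k s := by
    intro s hs
    have h1 := Convex.norm_image_sub_le_of_norm_deriv_le (f := vk n k) (C := D ^ (k + 2))
      (s := Set.univ) (x := 0) (y := s)
      (fun x _ => hdiff x) (fun x _ => hder x) convex_univ (Set.mem_univ _) (Set.mem_univ _)
    rw [sub_zero, Real.norm_eq_abs, Real.norm_eq_abs, abs_of_nonneg hs.1] at h1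
    have h2 := (abs_le.1 h1).1
    have h3 := gsh_vk_zero n k
    have h4 : D ^ (k + 2) * s ≤ (1 / 2) ^ (k + 1) := by
      calc D ^ (k + 2) * s ≤ D ^ (k + 2) * d := by
            have := hs.2
            gcongr
        _ ≤ D ^ (2 * (k + 1)) * d := by
            gcongr
            · linarith
            · omega
        _ = _ := by
            rw [hd, pow_mul, ← mul_pow]
            congr 1
            field_simp
    have h5 : (1 / 2 : ℝ) ^ k = 2 * (1 / 2) ^ (k + 1) := by rw [pow_succ]; ring
    linarith
  have hint : ∫ s in (0 : ℝ)..d, s ^ (2 * n) * ((1 / 2 : ℝ) ^ (k + 1)) ^ 2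
      = d ^ (2 * n + 1) / (2 * n + 1) * ((1 / 2 : ℝ) ^ (k + 1)) ^ 2 := by
    rw [intervalIntegral.integral_mul_const, integral_pow]
    push_cast
    simp
  have hN : (H ^ (k + 1))⁻¹ ≤ ∫ s : ℝ, s ^ (2 * n) * (vk n k s) ^ 2 := by
    calc (H ^ (k + 1))⁻¹ ≤ d ^ (2 * n + 1) / (2 * n + 1) * ((1 / 2 : ℝ) ^ (k + 1)) ^ 2 := by
          have e1 : d ^ (2 * n + 1) / (2 * n + 1) * ((1 / 2 : ℝ) ^ (k + 1)) ^ 2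
              = (((2 * D ^ 2) ^ (2 * n + 1)) ^ (k + 1) * (2 * n + 1) * 4 ^ (k + 1))⁻¹ := by
            rw [hd, ← pow_mul, ← pow_mul, ← pow_mul, mul_comm (k + 1) 2, pow_mul (1 / 2 : ℝ) 2,
              mul_comm (k + 1), one_div_pow, mul_inv, mul_inv, ← inv_pow 4]
            norm_num
            ring
          rw [e1]
          apply inv_anti₀ (by positivity)
          rw [hH, mul_pow (4 * (2 * (n : ℝ) + 1)), mul_pow (4 : ℝ)]
          have : (2 * n + 1 : ℝ) ≤ (2 * n + 1) ^ (k + 1) := le_self_pow₀ hn1 (by omega)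
          calc _ ≤ ((2 * D ^ 2) ^ (2 * n + 1)) ^ (k + 1) * (2 * n + 1) ^ (k + 1) * 4 ^ (k + 1) := by
                gcongr
            _ = _ := by ring
      _ = ∫ s in (0 : ℝ)..d, s ^ (2 * n) * ((1 / 2 : ℝ) ^ (k + 1)) ^ 2 := hint.symm
      _ ≤ ∫ s in (0 : ℝ)..d, s ^ (2 * n) * (vk n k s) ^ 2 := by
          refine intervalIntegral.integral_mono_on hd0.le
            (Continuous.intervalIntegrable (by fun_prop) _ _)
            ((gsh_integrable n k).intervalIntegrable) fun s hs => ?_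
          have h1 := hlow s hs
          have h2 := hs.1
          gcongr
      _ ≤ _ := by
          rw [intervalIntegral.integral_of_le hd0.le]
          refine setIntegral_le_integral (gsh_integrable n k)
            (Filter.Eventually.of_forall fun s => ?_)
          have : 0 ≤ s ^ (2 * n) := (even_two_mul n).pow_nonneg s
          show 0 ≤ s ^ (2 * n) * vk n k s ^ 2
          positivity
  have hHk : 1 ≤ H ^ (k + 1) := one_le_pow₀ hH1
  apply inv_le_of_inv_le₀ (by positivity)
  apply Real.le_sqrt_of_sq_le
  refine le_trans ?_ hN
  have h1 : (H ^ (k + 1))⁻¹ ≤ 1 := inv_le_one_of_one_le₀ hHk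
  have h0 : 0 < (H ^ (k + 1))⁻¹ := by positivity
  nlinarith

lemma gsh_main (n : ℕ) : ∃ Cv : ℝ, 0 < Cv ∧ ∀ k a b : ℕ, ∀ t : ℝ,
      |t ^ a * iteratedDeriv b (nvk n k) t| ≤
        Cv ^ (k + a + b + 1) *
          (Nat.factorial a : ℝ) ^ ((1 : ℝ) / (2 * (n : ℝ) + 2)) *
          (Nat.factorial b : ℝ) ^ ((2 * (n : ℝ) + 1) / (2 * (n : ℝ) + 2)) := by
  obtain ⟨D, hD, h⟩ := gsh_unnorm n
  obtain ⟨H, hH, h'⟩ := gsh_norm_lower n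
  refine ⟨D * H, by positivity, fun k a b t => ?_⟩
  set S := Real.sqrt (∫ s : ℝ, s ^ (2 * n) * (vk n k s) ^ 2) with hS
  have e : iteratedDeriv b (nvk n k) t = S⁻¹ * iteratedDeriv b (vk n k) t := by
    have : nvk n k = fun t => S⁻¹ * vk n k t := by
      funext t; rw [nvk, ← hS, div_eq_inv_mul]
    rw [this, iteratedDeriv_const_mul_field]
  have hS0 : 0 ≤ S⁻¹ := inv_nonneg.2 (Real.sqrt_nonneg _)
  rw [e, mul_left_comm, abs_mul, abs_of_nonneg hS0]
  have h1 := h k a b t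
  have h2 := h' k
  have h3 : H ^ (k + 1) ≤ H ^ (k + a + b + 1) := pow_le_pow_right₀ hH (by omega)
  refine (mul_le_mul (h2.trans h3) h1 (abs_nonneg _) (by positivity)).trans (le_of_eq ?_)
  rw [mul_pow]; ring

/-- Gel'fand–Shilov estimates for the normalized eigenfunctions:
`|t^α ∂_t^β v_k(t)| ≤ C_v^{k+α+β+1} (α!)^{1/(2n+2)} (β!)^{(2n+1)/(2n+2)}`;
in particular each `v_k` belongs to the Gel'fand–Shilov space
`S^{1/(2n+2)}_{(2n+1)/(2n+2)}(ℝ)`. -/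
theorem stmt_10 (n : ℕ) (hn : 0 < n) :
    (∃ Cv : ℝ, 0 < Cv ∧ ∀ k a b : ℕ, ∀ t : ℝ,
      |t ^ a * iteratedDeriv b (nvk n k) t| ≤
        Cv ^ (k + a + b + 1) *
          (Nat.factorial a : ℝ) ^ ((1 : ℝ) / (2 * (n : ℝ) + 2)) *
          (Nat.factorial b : ℝ) ^ ((2 * (n : ℝ) + 1) / (2 * (n : ℝ) + 2))) ∧
    (∀ k : ℕ, ∃ C A B : ℝ, 0 < C ∧ 0 < A ∧ 0 < B ∧
      ∀ p q : ℕ, ∀ t : ℝ,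
        |t ^ p * iteratedDeriv q (nvk n k) t| ≤
          C * A ^ p * B ^ q *
            (p : ℝ) ^ (((1 : ℝ) / (2 * (n : ℝ) + 2)) * (p : ℝ)) *
            (q : ℝ) ^ (((2 * (n : ℝ) + 1) / (2 * (n : ℝ) + 2)) * (q : ℝ))) := by
  obtain ⟨Cv, hC, h⟩ := gsh_main n
  refine ⟨⟨Cv, hC, h⟩, fun k => ⟨Cv ^ (k + 1), Cv, Cv, by positivity, hC, hC, fun p q t => ?_⟩⟩
  have key : ∀ (θ : ℝ) (p : ℕ), 0 ≤ θ → (Nat.factorial p : ℝ) ^ θ ≤ (p : ℝ) ^ (θ * (p : ℝ)) := by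
    intro θ p hθ
    have h1 : (Nat.factorial p : ℝ) ≤ (p : ℝ) ^ p := by exact_mod_cast Nat.factorial_le_pow p
    rw [mul_comm, Real.rpow_mul (by positivity), Real.rpow_natCast]
    gcongr
  refine (h k p q t).trans ?_
  have h1 := key ((1 : ℝ) / (2 * (n : ℝ) + 2)) p (by positivity)
  have h2 := key ((2 * (n : ℝ) + 1) / (2 * (n : ℝ) + 2)) q (by positivity)
  have e : Cv ^ (k + p + q + 1) = Cv ^ (k + 1) * Cv ^ p * Cv ^ q := by ring
  rw [e]
  gcongr
end
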